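/- arXiv:2107.01416 — 5 statements merged into one kernel-verified Lean document; each statement's English description precedes it below -/
import Mathlib

section
/- Let n, k be integers with k ≥ 2 and n = 6k-5 or n = 6k-8. A nonhamiltonian 2-connected graph G of order n with minimum degree exactly k has the maximum possible number of edges C(n-k,2) + k² if and only if G is isomorphic to K_k ∨ (K_{n-2k} + \overline{K_k}) or to G(n, n-1, k). -/
open SimpleGraph

/-- The degree of a vertex, as `Nat.card` of its neighbor set. -/
noncomputable def degN {V : Type*} (G : SimpleGraph V) (v : V) : ℕ :=
  Nat.card (G.neighborSet v)

/-- `G` has minimum degree exactly `k`. -/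
def MinDegreeEq {V : Type*} (G : SimpleGraph V) (k : ℕ) : Prop :=
  (∀ v, k ≤ degN G v) ∧ ∃ v, degN G v = k

/-- `G` is 2-connected: at least 3 vertices and deleting any vertex leaves a connected graph. -/
def TwoConnected {V : Type*} (G : SimpleGraph V) : Prop :=
  3 ≤ Nat.card V ∧ ∀ v : V, (G.induce {u | u ≠ v}).Connected

/-- The circumference of `G`: the length of a longest cycle (0 if there are none). -/
noncomputable def circ {V : Type*} (G : SimpleGraph V) : ℕ :=
  sSup {n | ∃ (v : V) (w : G.Walk v v), w.IsCycle ∧ w.length = n}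

/-- The detour order of `G`: the number of vertices of a longest path. -/
noncomputable def detour {V : Type*} (G : SimpleGraph V) : ℕ :=
  sSup {n | ∃ (u v : V) (p : G.Walk u v), p.IsPath ∧ p.length + 1 = n}

/-- The number of cliques of cardinality `s` in `G`. -/
noncomputable def cliquesN {V : Type*} (G : SimpleGraph V) (s : ℕ) : ℕ :=
  Nat.card {S : Finset V // G.IsNClique s S}

/-- The number of edges of `G`. -/
noncomputable def edgeCount {V : Type*} (G : SimpleGraph V) : ℕ :=
  Nat.card G.edgeSet

/-- `G` contains a Hamilton cycle. -/
def IsHamiltonianGr {V : Type*} (G : SimpleGraph V) : Prop :=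
  ∃ (v : V) (w : G.Walk v v), w.IsCycle ∧ ∀ u : V, u ∈ w.support

/-- `G` contains a Hamilton path. -/
def IsTraceableGr {V : Type*} (G : SimpleGraph V) : Prop :=
  ∃ (u v : V) (p : G.Walk u v), p.IsPath ∧ ∀ w : V, w ∈ p.support

/-- `f_s(n,c,k) = C(c+1-k, s) + (n-c-1+k)·C(k, s-1)`. -/
def fCliques (n c k s : ℕ) : ℕ :=
  Nat.choose (c + 1 - k) s + (n + k - c - 1) * Nat.choose k (s - 1)

/-- `g_s(n,c,k) = C(c+1-t, s) + (n-c-2+t)·C(t, s-1) + C(k, s-1)` with `t = ⌊c/2⌋`. -/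
def gCliques (n c k s : ℕ) : ℕ :=
  Nat.choose (c + 1 - c / 2) s + (n + c / 2 - c - 2) * Nat.choose (c / 2) (s - 1)
    + Nat.choose k (s - 1)

/-- `g_s(n,c,k,q) = q·C(k, s-1) + (n-q-c-1+t)·C(t, s-1) + C(c+1-t, s)` with `t = ⌊c/2⌋`. -/
def gCliquesQ (n c k q s : ℕ) : ℕ :=
  q * Nat.choose k (s - 1) + (n + c / 2 - q - c - 1) * Nat.choose (c / 2) (s - 1)
    + Nat.choose (c + 1 - c / 2) s

/-- `F(n,c,k) = K_k ∨ (K_{c+1-2k} + \overline{K_{n-c-1+k}})`, realized on `Fin n`: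
vertices `0,…,k-1` are the dominating clique `K_k`, vertices `k,…,c-k` extend it to
`K_{c+1-k}`, and vertices `c-k+1,…,n-1` form the independent part. -/
def Fgraph (n c k : ℕ) : SimpleGraph (Fin n) where
  Adj x y := x ≠ y ∧ (x.val < k ∨ y.val < k ∨ (x.val ≤ c - k ∧ y.val ≤ c - k))
  symm := ⟨by intro x y h; exact ⟨h.1.symm, by tauto⟩⟩
  loopless := ⟨by intro x h; exact h.1 rfl⟩

/-- `G(n,c,k)`: from `K_t ∨ (K_{c+1-2t} + \overline{K_{n-c-1+t}})` (with `t = ⌊c/2⌋`)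
delete `t-k` edges incident to one common vertex (the vertex `n-1`) of the independent
part, keeping only its `k` neighbors `0,…,k-1`. -/
def Ggraph (n c k : ℕ) : SimpleGraph (Fin n) :=
  (Fgraph n c (c / 2)).deleteEdges
    {e | ∃ x y : Fin n, e = s(x, y) ∧ x.val = n - 1 ∧ k ≤ y.val ∧ y.val < c / 2}


/-- `l` is a cyclic ordering of all the vertices with consecutive vertices adjacent. -/
def HamL {V : Type} (G : SimpleGraph V) (l : List V) : Prop :=
  ∃ h : l ≠ [], l.Nodup ∧ (∀ v, v ∈ l) ∧ l.IsChain G.Adj ∧ G.Adj (l.getLast h) (l.head h)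

lemma HamL.ham {V : Type} {G : SimpleGraph V} {l : List V} (hl : HamL G l)
    (h3 : 3 ≤ l.length) : IsHamiltonianGr G := by
  obtain ⟨hne, hnd, hall, hch, hcl⟩ := hl
  refine ⟨_, SimpleGraph.Walk.cons hcl (SimpleGraph.Walk.ofSupport l hne hch), ?_, ?_⟩
  · rw [SimpleGraph.Walk.isCycle_iff_isPath_tail_and_le_length]
    constructor
    · simp [SimpleGraph.Walk.isPath_def, hnd]
    · simp; omega
  · intro u
    simp [hall]

lemma HamL.rotate {V : Type} {G : SimpleGraph V} {a b : List V} (hl : HamL G (a ++ b)) :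
    HamL G (b ++ a) := by
  obtain ⟨hne, hnd, hall, hch, hcl⟩ := hl
  by_cases ha : a = []
  · subst ha; simp at *; exact ⟨hne, hnd, hall, by simpa using hch, by simpa using hcl⟩
  by_cases hb : b = []
  · subst hb; simp at *; exact ⟨ha, hnd, hall, by simpa using hch, by simpa using hcl⟩
  rw [List.isChain_append] at hch
  refine ⟨by simp [ha], ?_, ?_, ?_, ?_⟩
  · exact List.nodup_append_comm.1 hnd
  · intro v; have := hall v; simp at this ⊢; tauto
  · rw [List.isChain_append]
    refine ⟨hch.2.1, hch.1, ?_⟩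
    intro x hx y hy
    rw [List.getLast?_eq_some_getLast hb] at hx
    rw [List.head?_eq_some_head ha] at hy
    simp at hx hy
    subst hx hy
    simpa [List.getLast_append, List.head_append, ha, hb] using hcl
  · have := hch.2.2 (a.getLast ha) (by rw [List.getLast?_eq_some_getLast ha]; simp) (b.head hb)
      (by rw [List.head?_eq_some_head hb]; simp)
    simpa [List.getLast_append, List.head_append, ha, hb] using this

/-- From a Hamilton cycle of `G + uv`, get a Hamilton path of `G` with ends `u, v`. -/
lemma ham_path {V : Type} (G : SimpleGraph V) (hno : ¬ ∃ l, HamL G l)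
    (u v : V) (l : List V) (h3 : 3 ≤ l.length) (hl : HamL (G ⊔ edge u v) l) :
    ∃ (l : List V) (h : l ≠ []), l.Nodup ∧ (∀ v, v ∈ l) ∧ l.IsChain G.Adj ∧
      ((l.head h = u ∧ l.getLast h = v) ∨ (l.head h = v ∧ l.getLast h = u)) := by
  obtain ⟨l', hl', hlen, hbad⟩ : ∃ (l' : List V) (hl' : HamL (G ⊔ edge u v) l'),
      3 ≤ l'.length ∧ ¬ G.Adj (l'.getLast hl'.1) (l'.head hl'.1) := by
    by_cases hc : l.IsChain G.Adj
    · refine ⟨l, hl, h3, fun h => hno ⟨l, hl.1, hl.2.1, hl.2.2.1, hc, h⟩⟩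
    · rw [List.isChain_iff_getElem] at hc
      push Not at hc
      obtain ⟨i, hi, hadj⟩ := hc
      have hl2 : HamL (G ⊔ edge u v) (l.take (i+1) ++ l.drop (i+1)) := by simpa using hl
      refine ⟨_, hl2.rotate, ?_, ?_⟩
      · simp; omega
      · have hd : l.drop (i+1) ≠ [] := by simp; omega
        have ht : l.take (i+1) ≠ [] := by simp; intro h; simp [h] at h3
        simp only [List.getLast_append, List.head_append, ht, hd]
        simpa [List.getLast_eq_getElem, hd, ht, Nat.min_eq_left (Nat.le_of_lt hi)] using hadj
  obtain ⟨hne, hnd, hall, hch, hcl⟩ := hl'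
  have hends : (l'.head hne = u ∧ l'.getLast hne = v) ∨ (l'.head hne = v ∧ l'.getLast hne = u) := by
    simp only [sup_adj, edge_adj] at hcl
    tauto
  refine ⟨l', hne, hnd, hall, ?_, hends⟩
  rw [List.isChain_iff_getElem] at hch ⊢
  intro i hi
  have := hch i hi
  rw [List.head_eq_getElem, List.getLast_eq_getElem] at hends
  simp only [sup_adj, edge_adj] at this
  rcases this with h | ⟨h, -⟩
  · exact h
  · exfalso
    have key : ∀ a b (ha : a < l'.length) (hb : b < l'.length), l'[a] = l'[b] → a = b := by
      intro a b ha hb h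
      exact (hnd.getElem_inj_iff).1 h
    rcases hends with ⟨h1, h2⟩ | ⟨h1, h2⟩ <;> rcases h with ⟨h3, h4⟩ | ⟨h3, h4⟩
    · have := key _ _ _ _ (h4.trans h2.symm)
      have := key _ _ _ _ (h3.trans h1.symm)
      omega
    · have := key _ _ _ _ (h4.trans h1.symm)
      omega
    · have := key _ _ _ _ (h4.trans h1.symm)
      omega
    · have := key _ _ _ _ (h4.trans h2.symm)
      have := key _ _ _ _ (h3.trans h1.symm)
      omega

lemma ore_path {V : Type} [Fintype V] (G : SimpleGraph V) [DecidableRel G.Adj]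
    (hno : ¬ ∃ l, HamL G l) (l : List V) (h : l ≠ []) (hnd : l.Nodup) (hall : ∀ v, v ∈ l)
    (hch : l.IsChain G.Adj) (h2 : 2 ≤ l.length) :
    G.degree (l.head h) + G.degree (l.getLast h) + 1 ≤ l.length := by
  classical
  set u := l.head h with hu
  set v := l.getLast h with hv
  have hu0 : l[0]'(by omega) = u := by rw [hu, List.head_eq_getElem]
  have hvl : l[l.length - 1]'(by omega) = v := by rw [hv, List.getLast_eq_getElem]
  have key : ∀ a b (ha : a < l.length) (hb : b < l.length), l[a] = l[b] → a = b := by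
    intro a b ha hb h
    exact (hnd.getElem_inj_iff).1 h
  have cross : ∀ j (hj : j + 1 < l.length), G.Adj u l[j+1] → G.Adj v l[j] → False := by
    intro j hj h1 h2
    apply hno
    have hd : l.drop (j+1) ≠ [] := by simp; omega
    have ht : l.take (j+1) ≠ [] := by simp [h]
    have hch' : (l.take (j+1) ++ l.drop (j+1)).IsChain G.Adj := by simpa using hch
    rw [List.isChain_append] at hch'
    have hperm : (l.take (j+1) ++ (l.drop (j+1)).reverse).Perm l := by
      have : (l.take (j+1) ++ (l.drop (j+1)).reverse).Perm (l.take (j+1) ++ l.drop (j+1)) :=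
        List.Perm.append_left _ (List.reverse_perm _)
      simpa using this
    refine ⟨l.take (j+1) ++ (l.drop (j+1)).reverse, by simp [h], hperm.nodup_iff.2 hnd, 
      fun x => hperm.mem_iff.2 (hall x), ?_, ?_⟩
    · rw [List.isChain_append]
      refine ⟨hch'.1, ?_, ?_⟩
      · rw [List.isChain_reverse]
        exact hch'.2.1.imp (fun a b hab => hab.symm)
      · intro x hx y hy
        rw [List.getLast?_eq_some_getLast ht] at hx
        rw [List.head?_reverse, List.getLast?_eq_some_getLast hd] at hy
        simp [List.getLast_eq_getElem, Nat.min_eq_left (Nat.le_of_lt hj)] at hx hy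
        subst hx
        have : y = v := by
          rw [← hvl, ← hy]
          congr 1; omega
        rw [this]; exact h2.symm
    · have h1' := h1.symm
      rw [hu] at h1'
      have e1 : (l.take (j+1)).head ht = l.head h := by
        rw [List.head_eq_getElem, List.head_eq_getElem]; simp
      simpa [List.getLast_append, List.head_append, hd, ht, e1] using h1'
  have hA : G.degree u = ((Finset.univ : Finset (Fin (l.length - 1))).filter
      (fun j => G.Adj u (l[j.1+1]'(by omega)))).card := by
    symm
    rw [← SimpleGraph.card_neighborFinset_eq_degree]
    refine Finset.card_bij (fun j _ => l[j.1+1]'(by omega)) ?_ ?_ ?_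
    · intro j hj; simpa using hj
    · intro a _ b _ hab
      have := key _ _ _ _ hab
      ext; omega
    · intro b hb
      obtain ⟨m, hm, rfl⟩ := List.mem_iff_getElem.1 (hall b)
      have hm0 : m ≠ 0 := by
        rintro rfl
        simp [hu0] at hb
      refine ⟨⟨m-1, by omega⟩, ?_, ?_⟩
      · simp at hb ⊢
        have : m - 1 + 1 = m := by omega
        simpa [this] using hb
      · have : m - 1 + 1 = m := by omega
        simp [this]
  have hB : G.degree v = ((Finset.univ : Finset (Fin (l.length - 1))).filter
      (fun j => G.Adj v (l[j.1]'(by omega)))).card := by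
    symm
    rw [← SimpleGraph.card_neighborFinset_eq_degree]
    refine Finset.card_bij (fun j _ => l[j.1]'(by omega)) ?_ ?_ ?_
    · intro j hj; simpa using hj
    · intro a _ b _ hab
      have := key _ _ _ _ hab
      ext; omega
    · intro b hb
      obtain ⟨m, hm, rfl⟩ := List.mem_iff_getElem.1 (hall b)
      have hm0 : m ≠ l.length - 1 := by
        rintro rfl
        simp [hvl] at hb
      refine ⟨⟨m, by omega⟩, ?_, ?_⟩
      · simpa using hb
      · simp
  rw [hA, hB, ← Finset.card_union_of_disjoint]
  · have := Finset.card_le_univ ((Finset.univ : Finset (Fin (l.length - 1))).filter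
      (fun j => G.Adj u (l[j.1+1]'(by omega))) ∪ (Finset.univ : Finset (Fin (l.length - 1))).filter
      (fun j => G.Adj v (l[j.1]'(by omega))))
    rw [Fintype.card_fin] at this
    omega
  · rw [Finset.disjoint_left]
    intro j h1 h2
    simp at h1 h2
    exact cross j (by omega) h1 h2

lemma ham_top {V : Type} [Fintype V] (h2 : 2 ≤ Fintype.card V) :
    ∃ l, HamL (⊤ : SimpleGraph V) l := by
  classical
  have hlen : (Finset.univ : Finset V).toList.length = Fintype.card V := by simp
  have hnd : (Finset.univ : Finset V).toList.Nodup := Finset.nodup_toList _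
  have hne : (Finset.univ : Finset V).toList ≠ [] := by
    intro h; rw [h] at hlen; simp at hlen; omega
  refine ⟨(Finset.univ : Finset V).toList, hne, hnd, by simp, ?_, ?_⟩
  · exact List.Pairwise.isChain hnd
  · rw [top_adj, List.head_eq_getElem, List.getLast_eq_getElem]
    intro h
    have := (hnd.getElem_inj_iff).1 h
    omega

/-- Chvátal's theorem. -/
lemma chvatal {V : Type} [Fintype V] (G : SimpleGraph V) [DecidableRel G.Adj]
    (h3 : 3 ≤ Fintype.card V) (hno : ¬ IsHamiltonianGr G) :
    ∃ i, 2 * i < Fintype.card V ∧ (∃ u, G.degree u ≤ i) ∧ i ≤ (Finset.univ.filter (fun v => G.degree v ≤ i)).card ∧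
      Fintype.card V - i ≤
        (Finset.univ.filter (fun v => G.degree v + i + 1 ≤ Fintype.card V)).card := by
  classical
  have hlen : ∀ l : List V, l.Nodup → (∀ v, v ∈ l) → l.length = Fintype.card V := by
    intro l h1 h2
    rw [← List.toFinset_card_of_nodup h1]
    congr 1
    ext v; simp [h2]
  have hG : ¬ ∃ l, HamL G l := by
    rintro ⟨l, hl⟩
    exact hno (hl.ham (by rw [hlen l hl.2.1 hl.2.2.1]; exact h3))
  obtain ⟨M, hGM, hM⟩ := Set.Finite.exists_le_maximal
    (Set.toFinite {H : SimpleGraph V | ¬ ∃ l, HamL H l}) hG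
  have hMno : ¬ ∃ l, HamL M l := hM.1
  have hore : ∀ u v, u ≠ v → ¬ M.Adj u v → M.degree u + M.degree v + 1 ≤ Fintype.card V := by
    intro u v huv hadj
    have h1 : ∃ l, HamL (M ⊔ edge u v) l := by
      by_contra hc
      have := hM.2 hc le_sup_left
      apply hadj
      apply this
      simp [edge_adj, huv]
    obtain ⟨l, hl⟩ := h1
    obtain ⟨l', hne, hnd, hall, hch, hends⟩ := ham_path M hMno u v l
      (by rw [hlen l hl.2.1 hl.2.2.1]; exact h3) hl
    have := ore_path M hMno l' hne hnd hall hch (by rw [hlen l' hnd hall]; omega)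
    rw [hlen l' hnd hall] at this
    rcases hends with ⟨h1, h2⟩ | ⟨h1, h2⟩ <;> rw [h1, h2] at this <;> omega
  obtain ⟨⟨u, v⟩, huv, hmax⟩ : ∃ p ∈ Finset.univ.filter
      (fun p : V × V => p.1 ≠ p.2 ∧ ¬ M.Adj p.1 p.2), ∀ q ∈ Finset.univ.filter
      (fun p : V × V => p.1 ≠ p.2 ∧ ¬ M.Adj p.1 p.2),
        M.degree q.1 + M.degree q.2 ≤ M.degree p.1 + M.degree p.2 := by
    apply Finset.exists_max_image
    by_contra hc
    rw [Finset.not_nonempty_iff_eq_empty] at hc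
    apply hMno
    have : M = ⊤ := by
      ext a b
      rw [top_adj]
      refine ⟨fun h => h.ne, fun h => ?_⟩
      by_contra h'
      have : (a, b) ∈ (∅ : Finset (V × V)) := by rw [← hc]; simp [h, h']
      simp at this
    rw [this]
    exact ham_top (by omega)
  wlog hle : M.degree u ≤ M.degree v generalizing u v
  · refine this v u ?_ ?_ (by omega)
    · simp [adj_comm] at huv ⊢; tauto
    · intro q hq; have := hmax q hq; simp at this ⊢; omega
  simp only [Finset.mem_filter, Finset.mem_univ, true_and] at huv hmax
  have hsum := hore u v huv.1 huv.2
  have hdeg : ∀ x, G.degree x ≤ M.degree x := fun x => degree_le_of_le hGM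
  have hcount : ∀ x, (Finset.univ.filter (fun w => w ≠ x ∧ ¬ M.Adj x w)).card
      + M.degree x + 1 = Fintype.card V := by
    intro x
    have h1 := Finset.card_compl_add_card (insert x (M.neighborFinset x))
    rw [Finset.card_insert_of_notMem (by simp), card_neighborFinset_eq_degree] at h1
    rw [← h1, add_assoc]
    congr 2
    ext w; simp
  refine ⟨M.degree u, by omega, ⟨u, hdeg u⟩, ?_, ?_⟩
  · have h1 := hcount v
    refine le_trans (show M.degree u ≤ (Finset.univ.filter (fun w => w ≠ v ∧ ¬ M.Adj v w)).card
      by omega) (Finset.card_le_card ?_)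
    intro w hw
    simp at hw ⊢
    have := hmax (v, w) ⟨fun h => hw.1 h.symm, hw.2⟩
    have := hdeg w
    simp at *; omega
  · have h1 := hcount u
    have h2 : (insert u (Finset.univ.filter (fun w => w ≠ u ∧ ¬ M.Adj u w))).card =
      Fintype.card V - M.degree u := by
      rw [Finset.card_insert_of_notMem (by simp)]; omega
    rw [← h2]
    apply Finset.card_le_card
    intro w hw
    simp at hw ⊢
    have := hdeg w
    rcases hw with rfl | hw
    · omega
    · have := hmax (u, w) ⟨fun h => hw.1 h.symm, hw.2⟩
      simp at *; omega

lemma edge_count_split {V : Type} [Fintype V] [DecidableEq V] (G : SimpleGraph V)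
    [DecidableRel G.Adj] (S : Finset V) :
    2 * G.edgeFinset.card + ∑ s ∈ S, (S.filter (G.Adj s)).card =
      2 * (∑ s ∈ S, G.degree s) + ∑ v ∈ Sᶜ, (Sᶜ.filter (G.Adj v)).card := by
  have hdeg : ∀ v, G.degree v = (S.filter (G.Adj v)).card + (Sᶜ.filter (G.Adj v)).card := by
    intro v
    rw [← card_neighborFinset_eq_degree, ← Finset.card_union_of_disjoint]
    · congr 1
      ext w; simp; tauto
    · rw [Finset.disjoint_left]; intro w; simp; tauto
  have hsw : ∑ v ∈ Sᶜ, (S.filter (G.Adj v)).card = ∑ s ∈ S, (Sᶜ.filter (G.Adj s)).card := by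
    simp only [Finset.card_filter]
    rw [Finset.sum_comm]
    simp only [G.adj_comm]
  rw [← sum_degrees_eq_twice_card_edges, ← Finset.sum_add_sum_compl S]
  have h1 : ∑ v ∈ Sᶜ, G.degree v = ∑ v ∈ Sᶜ, (S.filter (G.Adj v)).card +
      ∑ v ∈ Sᶜ, (Sᶜ.filter (G.Adj v)).card := by
    rw [← Finset.sum_add_distrib]; exact Finset.sum_congr rfl fun v _ => hdeg v
  have h2 : ∑ v ∈ S, G.degree v = ∑ v ∈ S, (S.filter (G.Adj v)).card +
      ∑ v ∈ S, (Sᶜ.filter (G.Adj v)).card := by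
    rw [← Finset.sum_add_distrib]; exact Finset.sum_congr rfl fun v _ => hdeg v
  omega

/-- Vertex classes of the model graph. -/
def colF (n i k : ℕ) (x : ℕ) : Fin 5 :=
  if x < k then 0 else if x < i then 1 else if x < n - i then 2 else if x < n - 1 then 3 else 4

/-- Adjacency between vertex classes of the model graph. -/
def relF (a b : Fin 5) : Prop :=
  a = 0 ∨ b = 0 ∨ (a.val ≤ 2 ∧ b.val ≤ 2) ∨ (a = 1 ∧ b = 3) ∨ (a = 3 ∧ b = 1)

/-- The model graph. -/
def IsModel (n i k : ℕ) (A : SimpleGraph (Fin n)) : Prop :=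
  ∀ x y, A.Adj x y ↔ x ≠ y ∧ (relF (colF n i k x.val) (colF n i k y.val))

lemma card_Fin_Ico (n a b : ℕ) (hb : b ≤ n) :
    ((Finset.univ : Finset (Fin n)).filter (fun x => a ≤ x.val ∧ x.val < b)).card = b - a := by
  rw [← Nat.card_Ico a b]
  refine Finset.card_bij (fun x _ => x.val) ?_ ?_ ?_
  · intro x hx; simpa using hx
  · intro x _ y _ h; exact Fin.ext h
  · intro y hy; simp at hy; exact ⟨⟨y, by omega⟩, by simpa using hy, rfl⟩

lemma isModel_F (n k : ℕ) (hk : 1 ≤ k) (hn : 2 * k < n) : IsModel n k k (Fgraph n (n-1) k) := by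
  intro x y
  have hx := x.2
  have hy := y.2
  simp only [Fgraph]
  refine and_congr_right fun hxy => ?_
  have : x.val ≠ y.val := fun h => hxy (Fin.ext h)
  unfold colF relF
  split_ifs <;> simp <;> omega

lemma isModel_G (n k : ℕ) (hk : 1 ≤ k) (hkt : k ≤ (n-1)/2) :
    IsModel n ((n-1)/2) k (Ggraph n (n-1) k) := by
  intro x y
  have hx := x.2
  have hy := y.2
  simp only [Ggraph, Fgraph, deleteEdges_adj, Set.mem_ofPred_eq]
  have e : (∃ a b : Fin n, s(x, y) = s(a, b) ∧ a.val = n - 1 ∧ k ≤ b.val ∧ b.val < (n-1)/2) ↔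
     ((x.val = n - 1 ∧ k ≤ y.val ∧ y.val < (n-1)/2) ∨
      (y.val = n - 1 ∧ k ≤ x.val ∧ x.val < (n-1)/2)) := by
    constructor
    · rintro ⟨a, b, h, h2⟩
      rw [Sym2.eq_iff] at h
      rcases h with ⟨rfl, rfl⟩ | ⟨rfl, rfl⟩ <;> tauto
    · rintro (h | h)
      · exact ⟨x, y, rfl, h⟩
      · exact ⟨y, x, Sym2.eq_swap, h⟩
  rw [e, and_assoc]
  clear e
  refine and_congr_right fun hxy => ?_
  have : x.val ≠ y.val := fun h => hxy (Fin.ext h)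
  generalize hi : (n-1)/2 = i at *
  have : 2 * i < n := by omega
  unfold colF relF
  split_ifs <;> simp <;> omega

lemma model_count (n i k : ℕ) (hk : 1 ≤ k) (hki : k ≤ i) (hn : 2 * i < n)
    (A : SimpleGraph (Fin n)) [DecidableRel A.Adj] (hA : IsModel n i k A) :
    2 * A.edgeFinset.card = (n - i) * (n - i - 1) + 2 * ((i - 1) * i + k) := by
  classical
  have h := edge_count_split A (Finset.univ.filter (fun x : Fin n => n - i ≤ x.val ∧ x.val < n))
  set S := (Finset.univ.filter (fun x : Fin n => n - i ≤ x.val ∧ x.val < n)) with hS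
  have hScard : S.card = i := by rw [hS, card_Fin_Ico _ _ _ le_rfl]; omega
  have h1 : ∑ s ∈ S, (S.filter (A.Adj s)).card = 0 := by
    apply Finset.sum_eq_zero
    intro s hs
    rw [Finset.card_eq_zero, Finset.filter_eq_empty_iff]
    intro y hy hadj
    simp [hS] at hs hy
    rw [hA] at hadj
    replace hadj := hadj.2
    unfold colF relF at hadj
    split_ifs at hadj <;> simp at hadj <;> omega
  have h2 : ∑ v ∈ Sᶜ, (Sᶜ.filter (A.Adj v)).card = (n - i) * (n - i - 1) := by
    have hc : Sᶜ.card = n - i := by rw [Finset.card_compl, hScard]; simp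
    rw [Finset.sum_const_nat (m := n - i - 1), hc]
    intro v hv
    rw [← hc, ← Finset.card_erase_of_mem hv]
    congr 1
    ext y
    simp only [Finset.mem_filter, Finset.mem_erase, hA v y]
    constructor
    · rintro ⟨h1, h2, -⟩; exact ⟨fun h => h2 h.symm, h1⟩
    · rintro ⟨h1, h2⟩
      refine ⟨h2, fun h => h1 h.symm, ?_⟩
      simp [hS] at h2 hv
      have := y.2
      have := v.2
      unfold colF relF
      split_ifs <;> simp <;> omega
  have h3 : ∑ s ∈ S, A.degree s = (i - 1) * i + k := by
    have hmem : (⟨n - 1, by omega⟩ : Fin n) ∈ S := by simp [hS]; omega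
    rw [← Finset.sum_erase_add _ _ hmem]
    congr 1
    · rw [Finset.sum_const_nat (m := i), Finset.card_erase_of_mem hmem, hScard]
      intro s hs
      rw [← card_neighborFinset_eq_degree]
      conv_rhs => rw [← Nat.sub_zero i, ← card_Fin_Ico n 0 i (by omega)]
      congr 1
      ext y
      simp only [mem_neighborFinset, hA s y, Finset.mem_filter, Finset.mem_univ, true_and]
      simp [hS] at hs
      have hs1 : s.val ≠ n - 1 := fun h => hs.1 (Fin.ext h)
      have := y.2
      have := s.2
      rw [ne_eq, Fin.ext_iff]
      unfold colF relF
      split_ifs <;> simp <;> omega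
    · rw [← card_neighborFinset_eq_degree]
      conv_rhs => rw [← Nat.sub_zero k, ← card_Fin_Ico n 0 k (by omega)]
      congr 1
      ext y
      simp only [mem_neighborFinset, hA _ y, Finset.mem_filter, Finset.mem_univ, true_and]
      have := y.2
      rw [ne_eq, Fin.ext_iff]
      unfold colF relF
      split_ifs <;> simp <;> omega
  rw [h1, h2, h3] at h
  omega

set_option maxHeartbeats 2000000 in
lemma structure_lemma {V : Type} [Fintype V] [DecidableEq V] (G : SimpleGraph V)
    [DecidableRel G.Adj] (n i k : ℕ) (hV : Fintype.card V = n) (hk : 1 ≤ k) (hki : k ≤ i)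
    (hn : 2 * i < n) (v0 : V) (hv0 : G.degree v0 = k)
    (h1 : i ≤ (Finset.univ.filter (fun v => G.degree v ≤ i)).card)
    (h2 : n - i ≤ (Finset.univ.filter (fun v => G.degree v + i + 1 ≤ n)).card) :
    2 * G.edgeFinset.card ≤ (n - i) * (n - i - 1) + 2 * ((i - 1) * i + k) ∧
    (2 * G.edgeFinset.card = (n - i) * (n - i - 1) + 2 * ((i - 1) * i + k) →
      ∀ A : SimpleGraph (Fin n), IsModel n i k A → Nonempty (G ≃g A)) := by
  obtain ⟨S, hS0, hS1, hScard⟩ := Finset.exists_subsuperset_card_eq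
    (s := {v0}) (t := Finset.univ.filter (fun v => G.degree v ≤ i)) (n := i)
    (by simp [hv0, hki]) (by simp; omega) h1
  have hv0S : v0 ∈ S := hS0 (by simp)
  have hSdeg : ∀ s ∈ S, G.degree s ≤ i := fun s hs => by simpa using hS1 hs
  have hc : Sᶜ.card = n - i := by rw [Finset.card_compl, hScard, hV]
  have hcnt := edge_count_split G S
  have hsub : ∀ v, Sᶜ.filter (G.Adj v) ⊆ Sᶜ.erase v := by
    intro v y hy
    simp only [Finset.mem_filter, Finset.mem_erase] at hy ⊢
    exact ⟨fun h => hy.2.ne h.symm, hy.1⟩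
  have hle : ∀ v ∈ Sᶜ, (Sᶜ.filter (G.Adj v)).card ≤ n - i - 1 := by
    intro v hv
    rw [← hc, ← Finset.card_erase_of_mem hv]
    exact Finset.card_le_card (hsub v)
  have hsumT : ∑ v ∈ Sᶜ, (n - i - 1) = (n - i) * (n - i - 1) := by simp [hc]
  have hsumS : ∑ v ∈ S.erase v0, i = (i - 1) * i := by
    simp [Finset.card_erase_of_mem hv0S, hScard]
  have hT := Finset.sum_le_sum hle
  have hSle : ∀ s ∈ S.erase v0, G.degree s ≤ i := fun s hs => hSdeg s (Finset.mem_of_mem_erase hs)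
  have hSS := Finset.sum_le_sum hSle
  have hsplit := Finset.sum_erase_add S (fun s => G.degree s) hv0S
  rw [hv0] at hsplit
  rw [hsumT] at hT
  rw [hsumS] at hSS
  refine ⟨by omega, fun heq A hA => ?_⟩
  have e1 : ∑ v ∈ Sᶜ, (Sᶜ.filter (G.Adj v)).card = ∑ v ∈ Sᶜ, (n - i - 1) := by omega
  have e2 : ∑ s ∈ S.erase v0, G.degree s = ∑ s ∈ S.erase v0, i := by omega
  have e3 : ∑ s ∈ S, (S.filter (G.Adj s)).card = 0 := by omega
  rw [Finset.sum_eq_sum_iff_of_le hle] at e1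
  rw [Finset.sum_eq_sum_iff_of_le hSle] at e2
  rw [Finset.sum_eq_zero_iff] at e3
  have hind : ∀ s ∈ S, ∀ t ∈ S, ¬ G.Adj s t := by
    intro s hs t ht
    have := e3 s hs
    rw [Finset.card_eq_zero, Finset.filter_eq_empty_iff] at this
    exact this ht
  have hcl' : ∀ v ∈ Sᶜ, Sᶜ.filter (G.Adj v) = Sᶜ.erase v := by
    intro v hv
    apply Finset.eq_of_subset_of_card_le (hsub v)
    rw [e1 v hv, Finset.card_erase_of_mem hv, hc]
  have hcl : ∀ v ∈ Sᶜ, ∀ w ∈ Sᶜ, v ≠ w → G.Adj v w := by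
    intro v hv w hw hvw
    have : w ∈ Sᶜ.filter (G.Adj v) := by
      rw [hcl' v hv]; exact Finset.mem_erase.2 ⟨hvw.symm, hw⟩
    exact (Finset.mem_filter.1 this).2
  set Q := Sᶜ.filter (fun v => G.degree v + i + 1 ≤ n) with hQ
  have hQcard : n - 2 * i ≤ Q.card := by
    have : (Finset.univ.filter (fun v => G.degree v + i + 1 ≤ n)) ⊆ S ∪ Q := by
      intro v hv
      simp [hQ] at hv ⊢
      tauto
    have := (Finset.card_le_card this).trans (Finset.card_union_le _ _)
    omega
  have hQS : ∀ q ∈ Q, ∀ s ∈ S, ¬ G.Adj s q := by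
    intro q hq s hs hadj
    rw [hQ, Finset.mem_filter] at hq
    have hss : insert s (Sᶜ.filter (G.Adj q)) ⊆ G.neighborFinset q := by
      intro w hw
      rw [Finset.mem_insert] at hw
      rw [mem_neighborFinset]
      rcases hw with rfl | hw
      · exact hadj.symm
      · exact (Finset.mem_filter.1 hw).2
    have := Finset.card_le_card hss
    rw [Finset.card_insert_of_notMem (by simp [hs]), e1 q hq.1, card_neighborFinset_eq_degree] at this
    omega
  set T := Sᶜ \ Q with hTd
  have hQsub : Q ⊆ Sᶜ := Finset.filter_subset _ _
  have hTcard : T.card + Q.card = n - i := by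
    rw [hTd, Finset.card_sdiff_add_card_eq_card hQsub, hc]
  have hNsub : ∀ s ∈ S, G.neighborFinset s ⊆ T := by
    intro s hs w hw
    rw [mem_neighborFinset] at hw
    rw [hTd, Finset.mem_sdiff, Finset.mem_compl]
    exact ⟨fun h => hind s hs w h hw, fun h => hQS w h s hs hw⟩
  have hTi : T.card = i := by
    obtain ⟨s, hs, hsd⟩ : ∃ s ∈ S, G.degree s = i := by
      by_cases hik : i = k
      · exact ⟨v0, hv0S, by omega⟩
      · have : (S.erase v0).Nonempty := by
          rw [← Finset.card_pos, Finset.card_erase_of_mem hv0S]; omega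
        obtain ⟨s, hs⟩ := this
        exact ⟨s, Finset.mem_of_mem_erase hs, e2 s hs⟩
    have := Finset.card_le_card (hNsub s hs)
    rw [card_neighborFinset_eq_degree] at this
    omega
  have hNT : ∀ s ∈ S.erase v0, G.neighborFinset s = T := by
    intro s hs
    apply Finset.eq_of_subset_of_card_le (hNsub s (Finset.mem_of_mem_erase hs))
    rw [card_neighborFinset_eq_degree, e2 s hs, hTi]
  set T0 := G.neighborFinset v0 with hT0
  have hT0T : T0 ⊆ T := hNsub v0 hv0S
  have hT0card : T0.card = k := by rw [hT0, card_neighborFinset_eq_degree, hv0]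
  have hTS : ∀ x ∈ T, x ∉ S := fun x hx => by
    rw [hTd, Finset.mem_sdiff, Finset.mem_compl] at hx; exact hx.1
  have hTQ : ∀ x ∈ T, x ∉ Q := fun x hx => (Finset.mem_sdiff.1 hx).2
  have hQS' : ∀ x ∈ Q, x ∉ S := fun x hx => Finset.mem_compl.1 (hQsub hx)
  have hcov : ∀ x, x ∉ T → x ∉ Q → x ∈ S := by
    intro x hx1 hx2
    by_contra hx
    exact hx1 (Finset.mem_sdiff.2 ⟨Finset.mem_compl.2 hx, hx2⟩)
  let col : V → Fin 5 := fun x =>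
    if x ∈ T0 then 0 else if x ∈ T then 1 else if x ∈ Q then 2 else if x ≠ v0 then 3 else 4
  have hfib : ∀ c : Fin 5, Nonempty ({a : V // col a = c} ≃ {b : Fin n // colF n i k b.val = c}) := by
    intro c
    apply Fintype.card_eq.1
    rw [Fintype.card_subtype, Fintype.card_subtype]
    have aux : ∀ (X : Finset V) (a b : ℕ), b ≤ n → X.card = b - a → (∀ x, col x = c ↔ x ∈ X) →
        (∀ m, m < n → (colF n i k m = c ↔ a ≤ m ∧ m < b)) →
        (Finset.univ.filter (fun x => col x = c)).card =
        (Finset.univ.filter (fun x : Fin n => colF n i k x.val = c)).card := by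
      intro X a b hb hX hc1 hc2
      have : (Finset.univ.filter (fun x => col x = c)) = X := by ext x; simp [hc1]
      rw [this, hX, ← card_Fin_Ico n a b hb]
      congr 1
      ext x
      simp [hc2 x.val x.2]
    fin_cases c
    · apply aux T0 0 k (by omega) (by omega)
      · intro x; simp only [col]; split_ifs <;> simp <;> tauto
      · intro m hm; unfold colF; split_ifs <;> simp <;> omega
    · apply aux (T \ T0) k i (by omega) (by rw [Finset.card_sdiff_of_subset hT0T]; omega)
      · intro x; simp only [col, Finset.mem_sdiff]; split_ifs <;> simp <;> tauto
      · intro m hm; unfold colF; split_ifs <;> simp <;> omega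
    · apply aux Q i (n-i) (by omega) (by omega)
      · intro x
        have := hTQ x
        have := @hT0T x
        simp only [col]; split_ifs <;> simp <;> tauto
      · intro m hm; unfold colF; split_ifs <;> simp <;> omega
    · apply aux (S.erase v0) (n-i) (n-1) (by omega) (by rw [Finset.card_erase_of_mem hv0S]; omega)
      · intro x
        have := hTS x
        have := hQS' x
        have := @hT0T x
        have := hcov x
        simp only [col, Finset.mem_erase]; split_ifs <;> simp <;> tauto
      · intro m hm; unfold colF; split_ifs <;> simp <;> omega
    · apply aux {v0} (n-1) n (by omega) (by simp; omega)
      · intro x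
        have a1 := hTS v0
        have a2 := hQS' v0
        have a3 := @hT0T v0
        simp only [col, Finset.mem_singleton]
        split_ifs <;> simp <;> (try rintro rfl) <;> tauto
      · intro m hm; unfold colF; split_ifs <;> simp <;> omega
  let e := Equiv.ofFiberEquiv (f := col) (g := fun b : Fin n => colF n i k b.val)
    (fun c => (hfib c).some)
  have he : ∀ x, colF n i k (e x).val = col x := fun x =>
    Equiv.ofFiberEquiv_map (f := col) (g := fun b : Fin n => colF n i k b.val) _ x
  refine ⟨⟨e, ?_⟩⟩
  intro x y
  rw [hA, he, he]
  rw [show (e x ≠ e y ↔ x ≠ y) from e.injective.ne_iff]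
  -- adjacency rules
  have r1 : ∀ x y, x ∉ S → y ∉ S → x ≠ y → G.Adj x y := fun x y hx hy =>
    hcl x (Finset.mem_compl.2 hx) y (Finset.mem_compl.2 hy)
  have r2 : ∀ y, G.Adj v0 y ↔ y ∈ T0 := fun y => by rw [hT0, mem_neighborFinset]
  have r3 : ∀ x, x ∈ S → x ≠ v0 → ∀ y, (G.Adj x y ↔ y ∈ T) := fun x hx hx0 y => by
    rw [← hNT x (Finset.mem_erase.2 ⟨hx0, hx⟩), mem_neighborFinset]
  have hTS' : ∀ x ∈ S, x ∉ T := fun x hx h => hTS x h hx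
  have hT0S' : ∀ x ∈ S, x ∉ T0 := fun x hx h => hTS x (hT0T h) hx
  have hSQ' : ∀ x ∈ S, x ∉ Q := fun x hx h => hQS' x h hx
  have cS : ∀ x, x ∈ S → x ≠ v0 → col x = 3 := by
    intro x hx hx0
    simp only [col]
    simp [hTS' x hx, hT0S' x hx, hSQ' x hx, hx0]
  have cv : col v0 = 4 := by
    simp only [col]
    simp [hTS' _ hv0S, hT0S' _ hv0S, hSQ' _ hv0S]
  have cn : ∀ x, x ∉ S → (col x).val ≤ 2 ∧ (col x = 0 ↔ x ∈ T0) ∧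
      ((col x = 0 ∨ col x = 1) ↔ x ∈ T) ∧ col x ≠ 3 := by
    intro x hx
    have := hcov x
    have := @hT0T x
    simp only [col]
    split_ifs <;> simp <;> tauto
  by_cases hxy : x = y
  · subst hxy; simp
  simp only [ne_eq, hxy, not_false_eq_true, true_and]
  have mixed : ∀ x y, x ∈ S → y ∉ S → (relF (col x) (col y) ↔ G.Adj x y) := by
    intro x y hx hy
    obtain ⟨c1, c2, c3, c4⟩ := cn y hy
    by_cases hx0 : x = v0
    · subst hx0
      rw [r2, cv, ← c2]; simp [relF]
    · rw [r3 x hx hx0, cS x hx hx0, ← c3]; simp [relF]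
  have relsymm : ∀ a b, relF a b → relF b a := by
    intro a b; unfold relF; tauto
  by_cases hx : x ∈ S <;> by_cases hy : y ∈ S
  · have hno := hind x hx y hy
    simp only [hno, iff_false]
    have : ∀ z ∈ S, col z = 3 ∨ col z = 4 := by
      intro z hz
      by_cases hz0 : z = v0
      · right; rw [hz0, cv]
      · left; exact cS z hz hz0
    rcases this x hx with h | h <;> rcases this y hy with h' | h' <;> rw [h, h'] <;> simp [relF]
  · exact mixed x y hx hy
  · rw [G.adj_comm, ← mixed y x hy hx]
    exact ⟨relsymm _ _, relsymm _ _⟩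
  · have := r1 x y hx hy hxy
    simp only [this, iff_true]
    right; right; left
    exact ⟨(cn x hx).1, (cn y hy).1⟩

lemma two_mul_choose_two (m : ℕ) : 2 * Nat.choose m 2 = m * (m - 1) := by
  rw [Nat.choose_two_right]
  exact Nat.mul_div_cancel' (Nat.even_mul_pred_self m).two_dvd

lemma arith_identity (n i k : ℕ) (hki : k ≤ i) (hk : 1 ≤ k) (hn : 2 * i < n) :
    (((n - i) * (n - i - 1) + 2 * ((i - 1) * i + k) : ℕ) : ℤ) -
      (((n - k) * (n - k - 1) + 2 * k ^ 2 : ℕ) : ℤ) =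
      ((i : ℤ) - k) * (3 * i + 3 * k - 2 * n - 1) := by
  have a1 : ((n - i : ℕ) : ℤ) = n - i := by omega
  have a2 : ((n - i - 1 : ℕ) : ℤ) = n - i - 1 := by omega
  have a3 : ((n - k : ℕ) : ℤ) = n - k := by omega
  have a4 : ((n - k - 1 : ℕ) : ℤ) = n - k - 1 := by omega
  have a5 : ((i - 1 : ℕ) : ℤ) = i - 1 := by omega
  push_cast [a1, a2, a3, a4, a5]
  ring

theorem stmt6 (n k : ℕ) (hk : 2 ≤ k) (hn : n = 6 * k - 5 ∨ n = 6 * k - 8)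
    (V : Type) (G : SimpleGraph V) (hV : Nat.card V = n) (hconn : TwoConnected G)
    (hham : ¬ IsHamiltonianGr G) (hdeg : MinDegreeEq G k) :
    edgeCount G = Nat.choose (n - k) 2 + k ^ 2 ↔
      Nonempty (G ≃g Fgraph n (n - 1) k) ∨ Nonempty (G ≃g Ggraph n (n - 1) k) := by
  classical
  have h3 : 3 ≤ Nat.card V := hconn.1
  have : Finite V := Nat.finite_of_card_ne_zero (by omega)
  have : Fintype V := Fintype.ofFinite V
  rw [Nat.card_eq_fintype_card] at hV h3
  have hd : ∀ v, degN G v = G.degree v := by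
    intro v
    rw [degN, Nat.card_eq_fintype_card, card_neighborSet_eq_degree]
  have he : ∀ {W : Type} [Fintype W] (A : SimpleGraph W) [DecidableRel A.Adj],
      edgeCount A = A.edgeFinset.card := by
    intro W _ A _
    rw [edgeCount, Nat.card_eq_fintype_card, edgeFinset_card]
  have hiso : ∀ A : SimpleGraph (Fin n), Nonempty (G ≃g A) → edgeCount G = edgeCount A := by
    rintro A ⟨f⟩
    exact Nat.card_congr f.mapEdgeSet
  obtain ⟨hmin, v0, hv0⟩ := hdeg
  rw [hd] at hv0
  obtain ⟨i, hi, hlow, hc1, hc2⟩ := chvatal G h3 hham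
  rw [hV] at hi hc2
  have hki : k ≤ i := by
    obtain ⟨v, hv⟩ := hlow
    have h1 := hmin v
    rw [hd] at h1
    omega
  have hkn : 2 * k < n := by omega
  have ht : k ≤ (n-1)/2 := by omega
  have htn : 2 * ((n-1)/2) < n := by omega
  have id1 := arith_identity n i k hki (by omega) hi
  have id2 := arith_identity n ((n-1)/2) k ht (by omega) htn
  have idk := arith_identity n k k le_rfl (by omega) hkn
  have hz : (3 * (((n-1)/2 : ℕ) : ℤ) + 3 * k - 2 * n - 1) = 0 := by omega
  rw [hz, mul_zero] at id2
  rw [sub_self, zero_mul] at idk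
  have hch := two_mul_choose_two (n - k)
  constructor
  · intro hE
    have hE2 : 2 * G.edgeFinset.card = (n - k) * (n - k - 1) + 2 * k ^ 2 := by
      rw [← he G, hE]; omega
    obtain ⟨hb, hs⟩ := structure_lemma G n i k hV (by omega) hki hi v0 hv0 hc1 hc2
    have hcase : i = k ∨ i = (n-1)/2 := by
      by_contra hcon
      push Not at hcon
      have p1 : (0:ℤ) < (i:ℤ) - k := by omega
      have p2 : (3 * (i:ℤ) + 3 * k - 2 * n - 1) < 0 := by omega
      have := mul_neg_of_pos_of_neg p1 p2
      omega
    rcases hcase with rfl | rfl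
    · left
      exact hs (by omega) _ (isModel_F n i (by omega) hkn)
    · right
      exact hs (by omega) _ (isModel_G n k (by omega) ht)
  · rintro (h | h)
    · have h1 := hiso _ h
      have h2 := model_count n k k (by omega) le_rfl hkn _ (isModel_F n k (by omega) hkn)
      rw [← he] at h2
      omega
    · have h1 := hiso _ h
      have h2 := model_count n ((n-1)/2) k (by omega) ht htn _ (isModel_G n k (by omega) ht)
      rw [← he] at h2
      omega
end

section
/- Let n, p, k be integers with n-1 ≥ p-1 ≥ 2k ≥ 4 and set t = ⌊(p+1)/2⌋. The graph F'(n,p,k) = K_k ∨ (K_{p-2k} + \overline{K_{n-p+k}}) and the graph G'(n,p,k) obtained from K_{t-1} ∨ (K_{p+2-2t} + \overline{K_{n-p+t-1}}) by deleting t-1-k edges all incident to one common vertex of \overline{K_{n-p+t-1}} both have order n, minimum degree exactly k, and detour order exactly p; their numbers of edges are f(n, p-1, k) and g(n, p-1, k), respectively. -/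
open SimpleGraph

/-- Common generalization of the two graphs. -/
def Hgr (n c t k : ℕ) : SimpleGraph (Fin n) :=
  (Fgraph n c t).deleteEdges
    {e | ∃ x y : Fin n, e = s(x, y) ∧ x.val = n - 1 ∧ k ≤ y.val ∧ y.val < t}

theorem Hgr_adj (n c t k : ℕ) (x y : Fin n) : (Hgr n c t k).Adj x y ↔
    (x.val ≠ y.val ∧ (x.val < t ∨ y.val < t ∨ (x.val ≤ c - t ∧ y.val ≤ c - t))) ∧
    ¬ (x.val = n - 1 ∧ k ≤ y.val ∧ y.val < t) ∧ ¬ (y.val = n - 1 ∧ k ≤ x.val ∧ x.val < t) := by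
  unfold Hgr
  rw [SimpleGraph.deleteEdges_adj]
  simp only [Fgraph, Set.mem_ofPred_eq, ne_eq, Fin.ext_iff]
  refine and_congr_right fun _ => ?_
  rw [← not_or, not_iff_not]
  constructor
  · rintro ⟨a, b, h, h'⟩
    rw [Sym2.eq_iff] at h
    rcases h with ⟨rfl, rfl⟩ | ⟨rfl, rfl⟩
    · exact Or.inl h'
    · exact Or.inr h'
  · rintro (h | h)
    · exact ⟨x, y, rfl, h⟩
    · exact ⟨y, x, Sym2.eq_swap, h⟩

theorem Fgraph_eq_Hgr (n c k : ℕ) : Fgraph n c k = Hgr n c k k := by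
  ext x y
  rw [Hgr_adj]
  simp only [Fgraph, ne_eq, Fin.ext_iff]
  omega

theorem card_lt_fin (n m : ℕ) (h : m ≤ n) : Nat.card {x : Fin n // x.val < m} = m := by
  have e : {x : Fin n // x.val < m} ≃ Fin m :=
    { toFun := fun x => ⟨x.1.val, x.2⟩
      invFun := fun x => ⟨⟨x.val, by omega⟩, x.2⟩
      left_inv := fun x => rfl
      right_inv := fun x => rfl }
  rw [Nat.card_congr e, Nat.card_fin]

theorem Hgr_minDeg (n c t k : ℕ) (hk : 1 ≤ k) (hkt : k ≤ t) (htc : 2 * t ≤ c) (hcn : c + 1 ≤ n) :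
    MinDegreeEq (Hgr n c t k) k := by
  constructor
  · intro v
    unfold degN
    have : ∃ f : Fin k → (Hgr n c t k).neighborSet v, Function.Injective f := by
      refine ⟨fun i => ⟨⟨if i.val < v.val then i.val else i.val + 1, by
        split_ifs <;> omega⟩, ?_⟩, ?_⟩
      · rw [SimpleGraph.mem_neighborSet, Hgr_adj]
        have := i.2
        have := v.2
        dsimp only
        split_ifs <;> omega
      · intro i j h
        simp only [Subtype.mk.injEq, Fin.mk.injEq] at h
        ext
        split_ifs at h <;> omega
    obtain ⟨f, hf⟩ := this
    have := Nat.card_le_card_of_injective f hf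
    rwa [Nat.card_fin] at this
  · refine ⟨⟨n - 1, by omega⟩, ?_⟩
    unfold degN
    refine Eq.trans ?_ (card_lt_fin n k (by omega))
    apply Nat.card_congr
    apply Equiv.subtypeEquivRight
    intro x
    change (Hgr n c t k).Adj _ _ ↔ _
    rw [Hgr_adj]
    have := x.2
    dsimp only
    omega

theorem edgeCount_fin (n : ℕ) (G : SimpleGraph (Fin n)) :
    edgeCount G = ∑ y : Fin n, Nat.card {x : Fin n // x.val < y.val ∧ G.Adj x y} := by
  classical
  rw [← Nat.card_sigma]
  unfold edgeCount
  symm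
  let f : (Σ y : Fin n, {x : Fin n // x.val < y.val ∧ G.Adj x y}) → G.edgeSet :=
    fun a => ⟨s(a.2.1, a.1), a.2.2.2⟩
  apply Nat.card_congr (Equiv.ofBijective f _)
  constructor
  · rintro ⟨y, x, hx, hG⟩ ⟨y', x', hx', hG'⟩ h
    have h2 : s(x, y) = s(x', y') := congrArg Subtype.val h
    rw [Sym2.eq_iff] at h2
    rcases h2 with ⟨rfl, rfl⟩ | ⟨rfl, rfl⟩
    · rfl
    · omega
  · rintro ⟨e, he⟩
    induction e using Sym2.ind with
    | _ x y =>
      have hG : G.Adj x y := he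
      rcases lt_trichotomy x.val y.val with h | h | h
      · exact ⟨⟨y, x, h, hG⟩, rfl⟩
      · exact absurd (Fin.ext h) hG.ne
      · exact ⟨⟨x, y, h, hG.symm⟩, Subtype.ext Sym2.eq_swap⟩

theorem Hgr_edges (n c t k : ℕ) (hk : 1 ≤ k) (hkt : k ≤ t) (htc : 2 * t ≤ c) (hcn : c + 1 ≤ n) :
    edgeCount (Hgr n c t k) = Nat.choose (c + 1 - t) 2 + (n + t - c - 2) * t + k := by
  rw [edgeCount_fin]
  have h : ∀ y : Fin n, Nat.card {x : Fin n // x.val < y.val ∧ (Hgr n c t k).Adj x y} =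
      (fun i : ℕ => if i < c + 1 - t then i else if i < n - 1 then t else k) y.val := by
    intro y
    have hy := y.2
    dsimp only
    rw [← card_lt_fin n (if y.val < c + 1 - t then y.val else if y.val < n - 1 then t else k)
      (by split_ifs <;> omega)]
    apply Nat.card_congr
    apply Equiv.subtypeEquivRight
    intro x
    rw [Hgr_adj]
    split_ifs <;> omega
  rw [Finset.sum_congr rfl (fun y _ => h y),
    Fin.sum_univ_eq_sum_range (fun i : ℕ => if i < c + 1 - t then i else if i < n - 1 then t else k)]
  obtain ⟨r, rfl⟩ : ∃ r, n = (c + 1 - t + r) + 1 := ⟨n - 1 - (c + 1 - t), by omega⟩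
  rw [Finset.sum_range_succ, Finset.sum_range_add]
  have e1 : ∑ i ∈ Finset.range (c + 1 - t), (if i < c + 1 - t then i else
      if i < c + 1 - t + r + 1 - 1 then t else k) = Nat.choose (c + 1 - t) 2 := by
    rw [Nat.choose_two_right, ← Finset.sum_range_id]
    apply Finset.sum_congr rfl
    intro i hi
    rw [if_pos (Finset.mem_range.1 hi)]
  have e2 : ∑ i ∈ Finset.range r, (if c + 1 - t + i < c + 1 - t then c + 1 - t + i else
      if c + 1 - t + i < c + 1 - t + r + 1 - 1 then t else k) = r * t := by
    rw [Finset.sum_congr rfl (g := fun _ => t)]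
    · simp
    · intro i hi
      have := Finset.mem_range.1 hi
      rw [if_neg (by omega), if_pos (by omega)]
  rw [e1, e2, if_neg (by omega), if_neg (by omega)]
  congr 3
  omega

theorem exists_walk_of_fun {V : Type*} (G : SimpleGraph V) (f : ℕ → V) (m : ℕ)
    (h : ∀ i < m, G.Adj (f i) (f (i + 1))) :
    ∃ w : G.Walk (f 0) (f m), w.support = (List.range (m + 1)).map f ∧ w.length = m := by
  induction m with
  | zero => exact ⟨SimpleGraph.Walk.nil, by simp, rfl⟩
  | succ m ih =>
    obtain ⟨w, hw, hl⟩ := ih (fun i hi => h i (by omega))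
    refine ⟨w.concat (h m (by omega)), ?_, ?_⟩
    · rw [SimpleGraph.Walk.support_concat, hw, List.range_succ (n := m + 1)]
      simp
    · rw [SimpleGraph.Walk.length_concat, hl]

theorem Hgr_path (n c t k : ℕ) (hk : 1 ≤ k) (hkt : k ≤ t) (htc : 2 * t ≤ c) (hcn : c + 1 ≤ n) :
    ∃ (u v : Fin n) (p : (Hgr n c t k).Walk u v), p.IsPath ∧ p.length + 1 = c + 1 := by
  let g : ℕ → ℕ := fun i => if i = 0 then n - 1 else if i < 2 * t then
    (if i % 2 = 1 then i / 2 else c - t + i / 2) else if i ≤ c then i - t else 0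
  have hg : ∀ i, g i < n := by
    intro i
    dsimp only [g]
    split_ifs <;> omega
  obtain ⟨w, hw, hl⟩ := exists_walk_of_fun (Hgr n c t k) (fun i => ⟨g i, hg i⟩) c (by
    intro i hi
    rw [Hgr_adj]
    change (g i ≠ g (i + 1) ∧ (g i < t ∨ g (i + 1) < t ∨ (g i ≤ c - t ∧ g (i + 1) ≤ c - t))) ∧
      ¬ (g i = n - 1 ∧ k ≤ g (i + 1) ∧ g (i + 1) < t) ∧
      ¬ (g (i + 1) = n - 1 ∧ k ≤ g i ∧ g i < t)
    obtain ⟨a, ha⟩ : ∃ a, a = g i := ⟨_, rfl⟩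
    obtain ⟨b, hb⟩ : ∃ b, b = g (i + 1) := ⟨_, rfl⟩
    rw [← ha, ← hb]
    dsimp only [g] at ha hb
    clear hg
    split_ifs at ha hb <;> first | contradiction | omega)
  refine ⟨_, _, w, ?_, by omega⟩
  rw [SimpleGraph.Walk.isPath_def, hw]
  apply List.Nodup.map_on _ List.nodup_range
  intro i hi j hj hij
  rw [List.mem_range] at hi hj
  have hij' : g i = g j := congrArg Fin.val hij
  dsimp only [g] at hij'
  split_ifs at hij' <;> omega

theorem countP_le_card (n : ℕ) (l : List (Fin n)) (hl : l.Nodup) (a b : ℕ) :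
    l.countP (fun x => decide (a ≤ x.val ∧ x.val < b)) ≤ b - a := by
  rw [List.countP_eq_length_filter]
  have h1 : ((l.filter (fun x => decide (a ≤ x.val ∧ x.val < b))).map Fin.val).Nodup :=
    (hl.filter _).map Fin.val_injective
  rw [← List.length_map (f := Fin.val), ← List.toFinset_card_of_nodup h1, ← Nat.card_Ico]
  apply Finset.card_le_card
  intro x hx
  simp only [List.mem_toFinset, List.mem_map, List.mem_filter, decide_eq_true_eq] at hx
  obtain ⟨y, ⟨-, hy⟩, rfl⟩ := hx
  exact Finset.mem_Ico.2 hy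

theorem Hgr_walk (n c t k : ℕ) (htc : 2 * t ≤ c) (u v : Fin n)
    (w : (Hgr n c t k).Walk u v) :
    w.support.countP (fun x => decide (c + 1 - t ≤ x.val ∧ x.val < n)) +
      min 1 (w.support.countP (fun x => decide (t ≤ x.val ∧ x.val < c + 1 - t))) ≤
    w.support.countP (fun x => decide (0 ≤ x.val ∧ x.val < t)) + (if u.val < t then 0 else 1) ∧
    (t ≤ u.val ∧ u.val < c + 1 - t →
      1 ≤ w.support.countP (fun x => decide (t ≤ x.val ∧ x.val < c + 1 - t))) ∧
    w.support.length = w.support.countP (fun x => decide (c + 1 - t ≤ x.val ∧ x.val < n)) +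
      w.support.countP (fun x => decide (t ≤ x.val ∧ x.val < c + 1 - t)) +
      w.support.countP (fun x => decide (0 ≤ x.val ∧ x.val < t)) := by
  induction w with
  | nil =>
    rename_i u
    have := u.2
    simp only [SimpleGraph.Walk.support_nil, List.countP_cons, List.countP_nil,
      List.length_cons, List.length_nil, decide_eq_true_eq]
    split_ifs <;> omega
  | cons h p ih =>
    rename_i u v' w'
    have := u.2
    have := v'.2
    rw [Hgr_adj] at h
    simp only [SimpleGraph.Walk.support_cons, List.countP_cons,
      List.length_cons, decide_eq_true_eq]
    obtain ⟨i1, i2, i3⟩ := ih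
    generalize List.countP _ p.support = A at *
    generalize List.countP _ p.support = B at *
    generalize List.countP _ p.support = C at *
    split_ifs at i1 ⊢ <;> omega

theorem Hgr_detour (n c t k : ℕ) (hk : 1 ≤ k) (hkt : k ≤ t) (htc : 2 * t ≤ c) (hcn : c + 1 ≤ n) :
    detour (Hgr n c t k) = c + 1 := by
  unfold detour
  apply IsGreatest.csSup_eq
  refine ⟨Hgr_path n c t k hk hkt htc hcn, ?_⟩
  rintro m ⟨u, v, p, hp, rfl⟩
  obtain ⟨i1, i2, i3⟩ := Hgr_walk n c t k htc u v p
  have ha := countP_le_card n p.support hp.support_nodup 0 t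
  have hb := countP_le_card n p.support hp.support_nodup t (c + 1 - t)
  rw [SimpleGraph.Walk.length_support] at i3
  split_ifs at i1 <;> omega

theorem stmt9 (n p k : ℕ) (h1 : p - 1 ≤ n - 1) (h2 : 2 * k ≤ p - 1) (h3 : 2 ≤ k) :
    (Nat.card (Fin n) = n ∧ MinDegreeEq (Fgraph n (p - 1) k) k ∧
      detour (Fgraph n (p - 1) k) = p ∧
      edgeCount (Fgraph n (p - 1) k) = fCliques n (p - 1) k 2) ∧
    (MinDegreeEq (Ggraph n (p - 1) k) k ∧ detour (Ggraph n (p - 1) k) = p ∧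
      edgeCount (Ggraph n (p - 1) k) = gCliques n (p - 1) k 2) := by
  have hG : Ggraph n (p - 1) k = Hgr n (p - 1) ((p - 1) / 2) k := rfl
  have hp : p - 1 + 1 = p := by omega
  rw [hG, Fgraph_eq_Hgr]
  refine ⟨⟨Nat.card_fin n, ?_, ?_, ?_⟩, ?_, ?_, ?_⟩
  · apply Hgr_minDeg <;> omega
  · rw [Hgr_detour] <;> omega
  · rw [Hgr_edges _ _ _ _ (by omega) (by omega) (by omega) (by omega)]
    unfold fCliques
    obtain ⟨r, hr⟩ : ∃ r, n + k - (p - 1) - 2 = r := ⟨_, rfl⟩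
    have hr' : n + k - (p - 1) - 1 = r + 1 := by omega
    rw [hr, hr']
    simp only [Nat.add_one_sub_one, Nat.choose_one_right]
    ring
  · apply Hgr_minDeg <;> omega
  · rw [Hgr_detour] <;> omega
  · rw [Hgr_edges _ _ _ _ (by omega) (by omega) (by omega) (by omega)]
    unfold gCliques
    simp
end

section
/- Let n, c, k, s, q be integers with n-1 ≥ c ≥ 2k ≥ 4, s ≥ 2 and 1 ≤ q ≤ k. If G is a 2-connected graph of order n with circumference c, minimum degree k, and at least q vertices of degree k, then N_s(G) ≤ max{f_s(n,c,k), g_s(n,c,k,q)}. -/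
open SimpleGraph

/-! ### Paths with prescribed vertex sets -/

/-- `PS G x y S`: there is a path from `x` to `y` in `G` with vertex set exactly `S`. -/
inductive PS {V : Type} [DecidableEq V] (G : SimpleGraph V) : V → V → Finset V → Prop
  | nil (x : V) (S : Finset V) (h : S = {x}) : PS G x x S
  | cons (z x y : V) (S T : Finset V) (ha : G.Adj z x) (hz : z ∉ S) (hp : PS G x y S)
      (hT : T = insert z S) : PS G z y T

namespace PS

variable {V : Type} [DecidableEq V] {G : SimpleGraph V}

theorem left_mem {x y : V} {S : Finset V} (h : PS G x y S) : x ∈ S := by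
  cases h <;> simp_all

theorem right_mem {x y : V} {S : Finset V} (h : PS G x y S) : y ∈ S := by
  induction h <;> simp_all

theorem mono {H : SimpleGraph V} (hGH : G ≤ H) {x y : V} {S : Finset V} (h : PS G x y S) :
    PS H x y S := by
  induction h with
  | nil x S h => exact PS.nil x S h
  | cons z x y S T ha hz hp hT ih => exact PS.cons z x y S T (hGH ha) hz ih hT

theorem eq_singleton {x y : V} {S : Finset V} (h : PS G x y S) (hxy : x = y) : S = {x} := by
  cases h with
  | nil _ _ h => exact h
  | cons _ x' _ S _ ha hz hp hT => exact absurd (hxy ▸ hp.right_mem) hz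

/-- Join two disjoint paths by an edge. -/
theorem join {x y : V} {S : Finset V} (h : PS G x y S) : ∀ {u v : V} {T : Finset V},
    PS G u v T → G.Adj y u → (∀ z ∈ S, z ∉ T) → PS G x v (S ∪ T) := by
  induction h with
  | nil x S h =>
    intro u v T hT ha hd
    exact PS.cons x u v T _ ha (hd x (by simp [h])) hT (by subst h; ext; simp)
  | cons z x y S S' ha hz hp hT ih =>
    intro u v T hT' ha' hd
    subst hT
    refine PS.cons z x v (S ∪ T) _ ha ?_ (ih hT' ha' (by grind)) (by ext; simp)
    have := hd z (by simp)
    simp [hz, this]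

theorem symm {x y : V} {S : Finset V} (h : PS G x y S) : PS G y x S := by
  induction h with
  | nil x S h => exact PS.nil x S h
  | cons z x y S T ha hz hp hT ih =>
    have := ih.join (PS.nil z {z} rfl) ha.symm (by grind)
    rw [hT]
    convert this using 1
    ext; simp

theorem trans {x y z : V} {S T : Finset V} (h : PS G x y S) (h' : PS G y z T)
    (hd : ∀ w ∈ S, w ∈ T → w = y) : PS G x z (S ∪ T) := by
  cases h' with
  | nil _ _ hT =>
    have := h.right_mem
    convert h using 1
    subst hT; ext; simp; rintro rfl; exact this
  | cons _ y' _ T' _ ha hz hp hT =>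
    have := h.join hp ha (by grind)
    convert this using 1
    have := h.right_mem
    subst hT; ext; grind

theorem split {x y : V} {S : Finset V} (h : PS G x y S) : ∀ v ∈ S,
    ∃ S1 S2, PS G x v S1 ∧ PS G v y S2 ∧ S = S1 ∪ S2 ∧ (∀ w ∈ S1, w ∈ S2 → w = v) := by
  induction h with
  | nil x S h =>
    intro v hv
    subst h
    rw [Finset.mem_singleton] at hv
    subst hv
    exact ⟨{v}, {v}, PS.nil v _ rfl, PS.nil v _ rfl, by simp, by simp⟩
  | cons z x y S T ha hz hp hT ih =>
    intro v hv
    subst hT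
    by_cases hvz : v = z
    · subst hvz
      exact ⟨{v}, insert v S, PS.nil v _ rfl, PS.cons v x y S _ ha hz hp rfl, by ext; simp,
        by simp⟩
    · obtain ⟨S1, S2, h1, h2, h3, h4⟩ := ih v (by grind)
      exact ⟨insert z S1, S2, PS.cons z x v S1 _ ha (by grind) h1 rfl, h2, by grind, by grind⟩

/-- Two paths between the same (distinct) ends, otherwise disjoint, form a cycle. -/
theorem close {x y : V} {S T : Finset V} (h : PS G x y S) (h' : PS G x y T) (hxy : x ≠ y)
    (hd : ∀ w ∈ S, w ∈ T → w = x ∨ w = y) : ∃ z, PS G x z (S ∪ T) ∧ G.Adj z x := by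
  have hx := h.left_mem
  cases h' with
  | nil _ _ hT => exact absurd rfl hxy
  | cons _ z _ T' _ ha hz hp hT =>
    refine ⟨z, ?_, ha.symm⟩
    have := h.trans hp.symm (by grind)
    convert this using 1
    subst hT; ext; grind

theorem trim {A B : Finset V} {u w : V} {R : Finset V} (h : PS G u w R) (hu : u ∈ A)
    (hw : w ∈ B) : ∃ u' w' R', PS G u' w' R' ∧ u' ∈ A ∧ w' ∈ B ∧ R' ⊆ R ∧
      (∀ z ∈ R', z ∈ A → z = u') ∧ (∀ z ∈ R', z ∈ B → z = w') := by
  induction hn : R.card using Nat.strong_induction_on generalizing u w R with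
  | _ n ih =>
    by_cases hA : ∀ z ∈ R, z ∈ A → z = u
    · by_cases hB : ∀ z ∈ R, z ∈ B → z = w
      · exact ⟨u, w, R, h, hu, hw, subset_rfl, hA, hB⟩
      · push Not at hB
        obtain ⟨z, hz, hzB, hzw⟩ := hB
        obtain ⟨S1, S2, h1, h2, h3, h4⟩ := h.split z hz
        have hlt : S1.card < n := by
          rw [← hn]
          apply Finset.card_lt_card
          rw [Finset.ssubset_iff_of_subset (by rw [h3]; exact Finset.subset_union_left)]
          have := h2.right_mem
          exact ⟨w, by grind, by grind⟩
        obtain ⟨u', w', R', h5, h6, h7, h8, h9⟩ := ih _ hlt h1 hu hzB rfl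
        exact ⟨u', w', R', h5, h6, h7, by grind, h9⟩
    · push Not at hA
      obtain ⟨z, hz, hzA, hzu⟩ := hA
      obtain ⟨S1, S2, h1, h2, h3, h4⟩ := h.split z hz
      have hlt : S2.card < n := by
        rw [← hn]
        apply Finset.card_lt_card
        rw [Finset.ssubset_iff_of_subset (by rw [h3]; exact Finset.subset_union_right)]
        have := h1.left_mem
        exact ⟨u, by grind, by grind⟩
      obtain ⟨u', w', R', h5, h6, h7, h8, h9⟩ := ih _ hlt h2 hzA hw rfl
      exact ⟨u', w', R', h5, h6, h7, by grind, h9⟩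

/-- Conversion to an indexed path. -/
theorem index {x y : V} {S : Finset V} (h : PS G x y S) : ∃ (m : ℕ) (p : ℕ → V),
    p 0 = x ∧ p m = y ∧ S = (Finset.Icc 0 m).image p ∧
    (∀ i ≤ m, ∀ j ≤ m, p i = p j → i = j) ∧ (∀ i < m, G.Adj (p i) (p (i + 1))) := by
  induction h with
  | nil x S h => exact ⟨0, fun _ => x, rfl, rfl, by simp [h], by intros; omega, by simp⟩
  | cons z x y S T ha hz hp hT ih =>
    obtain ⟨m, p, h0, hm, hS, hinj, hadj⟩ := ih
    have hzp : ∀ i ≤ m, p i ≠ z := by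
      intro i hi he
      apply hz
      rw [hS, Finset.mem_image]
      exact ⟨i, by simp [hi], he⟩
    refine ⟨m + 1, fun i => Nat.casesOn i z p, rfl, hm, ?_, ?_, ?_⟩
    · subst hT
      ext w
      rw [hS]
      simp only [Finset.mem_insert, Finset.mem_image, Finset.mem_Icc]
      constructor
      · rintro (rfl | ⟨i, hi, rfl⟩)
        · exact ⟨0, by simp, rfl⟩
        · exact ⟨i + 1, by omega, rfl⟩
      · rintro ⟨i, hi, rfl⟩
        cases i with
        | zero => left; rfl
        | succ i => right; exact ⟨i, by omega, rfl⟩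
    · intro i hi j hj he
      cases i with
      | zero =>
        cases j with
        | zero => rfl
        | succ j => exact absurd he.symm (hzp j (by omega))
      | succ i =>
        cases j with
        | zero => exact absurd he (hzp i (by omega))
        | succ j => rw [hinj i (by omega) j (by omega) he]
    · intro i hi
      cases i with
      | zero => show G.Adj z (p 0); rw [h0]; exact ha
      | succ i => exact hadj i (by omega)

theorem seg {m : ℕ} {p : ℕ → V} (hinj : ∀ i ≤ m, ∀ j ≤ m, p i = p j → i = j)
    (hadj : ∀ i < m, G.Adj (p i) (p (i + 1))) (i d : ℕ) (h : i + d ≤ m) :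
    PS G (p i) (p (i + d)) ((Finset.Icc i (i + d)).image p) := by
  induction d with
  | zero => exact PS.nil _ _ (by simp)
  | succ d ih =>
    have := (ih (by omega)).join (PS.nil (p (i + d + 1)) _ rfl) (hadj (i + d) (by omega)) (by
      intro z hz hz'
      simp only [Finset.mem_image, Finset.mem_Icc, Finset.mem_singleton] at hz hz'
      obtain ⟨l, hl, rfl⟩ := hz
      have := hinj l (by omega) _ (by omega) hz'
      omega)
    refine Eq.mp (congrArg _ ?_) this
    ext w
    symm
    simp only [Finset.mem_image, Finset.mem_Icc, Finset.mem_union, Finset.mem_singleton]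
    constructor
    · rintro ⟨l, hl, rfl⟩
      by_cases h' : l = i + d + 1
      · right; rw [h']
      · left; exact ⟨l, by omega, rfl⟩
    · rintro (⟨l, hl, rfl⟩ | rfl)
      · exact ⟨l, by omega, rfl⟩
      · exact ⟨i + d + 1, by omega, rfl⟩

theorem seg' {m : ℕ} {p : ℕ → V} (hinj : ∀ i ≤ m, ∀ j ≤ m, p i = p j → i = j)
    (hadj : ∀ i < m, G.Adj (p i) (p (i + 1))) (i j : ℕ) (hij : i ≤ j) (h : j ≤ m) :
    PS G (p i) (p j) ((Finset.Icc i j).image p) := by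
  obtain ⟨d, rfl⟩ := Nat.exists_eq_add_of_le hij
  exact seg hinj hadj i d h

end PS

/-- Path formulation: every vertex-deleted subgraph is connected. -/
def PConn {V : Type} [DecidableEq V] (G : SimpleGraph V) : Prop :=
  ∀ v x y, x ≠ v → y ≠ v → ∃ S, PS G x y S ∧ v ∉ S

theorem aug_ext {V : Type} [DecidableEq V] {G : SimpleGraph V} {A B Q2 R : Finset V} {x b w e : V}
    (hQ : PS G x b Q2) (hR : PS G x w R) (hQR : ∀ z ∈ Q2, z ∈ R → z = x)
    (hQB : ∀ z ∈ Q2, z ∈ B → z = b) (hRB : ∀ z ∈ R, z ∈ B → z = w)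
    (hQA : ∀ z ∈ Q2, z ∈ A → z = x) (hRA : ∀ z ∈ R, z ∈ A → z = x)
    (hb : b ∈ B) (hw : w ∈ B) (he : e ∈ B ∪ Q2 ∪ R) (hex : e ≠ x) :
    ∃ b1 b2 T1 T2, PS G x b1 T1 ∧ PS G e b2 T2 ∧ T1 ⊆ B ∪ Q2 ∪ R ∧ T2 ⊆ B ∪ Q2 ∪ R ∧
      b1 ∈ B ∧ b2 ∈ B ∧
      (∀ z ∈ T1, z ∈ B → z = b1) ∧ (∀ z ∈ T2, z ∈ B → z = b2) ∧ (∀ z ∈ T1, z ∉ T2) ∧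
      (∀ z ∈ T1, z ∈ A → z = x) ∧ (∀ z ∈ T2, z ∈ A → z = e) ∧ (b1 = b ∨ b2 = b) := by
  by_cases h1 : e ∈ Q2
  · obtain ⟨S1, S2, h2, h3, h4, h5⟩ := hQ.split e h1
    have := h2.left_mem
    have hx : x ∉ S2 := by grind
    exact ⟨w, b, R, S2, hR, h3, by grind, by grind, hw, hb, hRB, by grind, by grind, hRA, by grind,
      Or.inr rfl⟩
  · by_cases h1' : e ∈ R
    · obtain ⟨S1, S2, h2, h3, h4, h5⟩ := hR.split e h1'
      have := h2.left_mem
      have hx : x ∉ S2 := by grind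
      exact ⟨b, w, Q2, S2, hQ, h3, by grind, by grind, hb, hw, hQB, by grind, by grind, hQA,
        by grind, Or.inl rfl⟩
    · exact ⟨b, e, Q2, {e}, hQ, PS.nil e _ rfl, by grind, by grind, hb, by grind, hQB, by grind,
        by grind, hQA, by grind, Or.inl rfl⟩

theorem aug {V : Type} [DecidableEq V] {G : SimpleGraph V} (hG : PConn G) (A : Finset V) (a : V)
    (haA : a ∈ A) (hA2 : ∃ u ∈ A, u ≠ a) (N : ℕ) : ∀ (B Q : Finset V) (b : V), Q.card ≤ N →
    PS G a b Q → b ∈ B → (∀ v, ∃ u ∈ B, u ≠ v) → (∀ z ∈ Q, z ∈ A → z = a) →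
    (∀ z ∈ Q, z ∈ B → z = b) →
    ∃ f e1 e2 S1 S2, PS G a e1 S1 ∧ PS G f e2 S2 ∧ f ∈ A ∧ e1 ∈ B ∧ e2 ∈ B ∧
      (∀ z ∈ S1, z ∈ A → z = a) ∧ (∀ z ∈ S2, z ∈ A → z = f) ∧
      (∀ z ∈ S1, z ∈ B → z = e1) ∧ (∀ z ∈ S2, z ∈ B → z = e2) ∧
      (∀ z ∈ S1, z ∉ S2) ∧ (e1 = b ∨ e2 = b) := by
  induction N with
  | zero =>
    intro B Q b hc hQ
    have := hQ.left_mem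
    have := Finset.card_pos.2 ⟨_, this⟩
    omega
  | succ N ih =>
    intro B Q b hc hQ hbB hB2 hQA hQB
    obtain ⟨u, huA, hub⟩ : ∃ u ∈ A, u ≠ b := by
      by_cases h : a = b
      · rw [← h]; exact hA2
      · exact ⟨a, haA, h⟩
    obtain ⟨w0, hw0, hw0b⟩ := hB2 b
    obtain ⟨R0, hR0, hbR0⟩ := hG b u w0 hub hw0b
    obtain ⟨x, w, R, hR, hxA, hwB, hRR, hRA, hRB⟩ := hR0.trim (A := A ∪ Q) (B := B)
      (by grind) hw0
    by_cases hxQ : x ∈ Q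
    · obtain ⟨Q1, Q2, hQ1, hQ2, hQQ, hQ12⟩ := hQ.split x hxQ
      have hxR := hR.left_mem
      have hxb : x ≠ b := by grind
      have hbQ2 := hQ2.right_mem
      have haQ1 := hQ1.left_mem
      have hbQ1 : b ∉ Q1 := by grind
      have hxQ1 := hQ1.right_mem
      have hlt : Q1.card < Q.card := by
        apply Finset.card_lt_card
        rw [Finset.ssubset_iff_of_subset (by rw [hQQ]; exact Finset.subset_union_left)]
        exact ⟨b, by grind, by grind⟩
      obtain ⟨f, e1, e2, S1, S2, h1, h2, h3, h4, h5, h6, h7, h8, h9, h10, h11⟩ :=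
        ih (B ∪ Q2 ∪ R) Q1 x (by omega) hQ1 (by grind)
          (by intro v; obtain ⟨u, hu, huv⟩ := hB2 v; exact ⟨u, by grind, huv⟩)
          (by grind) (by grind)
      have he1 := h1.right_mem
      have he2 := h2.right_mem
      have hne : e1 ≠ e2 := by grind
      have key : ∃ b1 b2 T1 T2, PS G e1 b1 T1 ∧ PS G e2 b2 T2 ∧ T1 ⊆ B ∪ Q2 ∪ R ∧
          T2 ⊆ B ∪ Q2 ∪ R ∧ b1 ∈ B ∧ b2 ∈ B ∧
          (∀ z ∈ T1, z ∈ B → z = b1) ∧ (∀ z ∈ T2, z ∈ B → z = b2) ∧ (∀ z ∈ T1, z ∉ T2) ∧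
          (∀ z ∈ T1, z ∈ A → z = e1) ∧ (∀ z ∈ T2, z ∈ A → z = e2) ∧ (b1 = b ∨ b2 = b) := by
        rcases h11 with rfl | rfl
        · exact aug_ext hQ2 hR (by grind) (by grind) (by grind) (by grind) (by grind) hbB hwB h5
            hne.symm
        · obtain ⟨b1, b2, T1, T2, g1, g2, g3, g4, g5, g6, g7, g8, g9, g10, g11, g12⟩ :=
            aug_ext (A := A) hQ2 hR (by grind) (by grind) (by grind) (by grind) (by grind) hbB hwB
              h4 hne
          exact ⟨b2, b1, T2, T1, g2, g1, g4, g3, g6, g5, g8, g7, by grind, g11, g10, g12.symm⟩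
      obtain ⟨b1, b2, T1, T2, g1, g2, g3, g4, g5, g6, g7, g8, g9, g10, g11, g12⟩ := key
      have i1 := g1.left_mem
      have i2 := g2.left_mem
      refine ⟨f, b1, b2, S1 ∪ T1, S2 ∪ T2, h1.trans g1 ?_, h2.trans g2 ?_, h3, g5, g6,
        ?_, ?_, ?_, ?_, ?_, g12⟩
      · intro z hz hz'; exact h8 z hz (g3 hz')
      · intro z hz hz'; exact h9 z hz (g4 hz')
      · intro z hz hzA
        rcases Finset.mem_union.1 hz with hz | hz
        · exact h6 z hz hzA
        · have := g10 z hz hzA; subst this; exact h6 z he1 hzA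
      · intro z hz hzA
        rcases Finset.mem_union.1 hz with hz | hz
        · exact h7 z hz hzA
        · have := g11 z hz hzA; subst this; exact h7 z he2 hzA
      · intro z hz hzB
        rcases Finset.mem_union.1 hz with hz | hz
        · have := h8 z hz (by grind); subst this; exact g7 z i1 hzB
        · exact g7 z hz hzB
      · intro z hz hzB
        rcases Finset.mem_union.1 hz with hz | hz
        · have := h9 z hz (by grind); subst this; exact g8 z i2 hzB
        · exact g8 z hz hzB
      · intro z hz hz'
        rcases Finset.mem_union.1 hz with hz | hz <;> rcases Finset.mem_union.1 hz' with hz' | hz'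
        · exact h10 z hz hz'
        · have := h8 z hz (g4 hz'); subst this; exact g9 z i1 hz'
        · have := h9 z hz' (g3 hz); subst this; exact g9 z hz i2
        · exact g9 z hz hz'
    · exact ⟨x, b, w, Q, R, hQ, hR, by grind, hbB, hwB, hQA, by grind, hQB, hRB, by grind,
        Or.inl rfl⟩

/-! ### Kopylov's lemma on long cycles from a long path -/

section Kopylov

variable {V : Type} [DecidableEq V] {G : SimpleGraph V}

theorem kop_left {m : ℕ} {p : ℕ → V} (hinj : ∀ i ≤ m, ∀ j ≤ m, p i = p j → i = j)
    (hadj : ∀ i < m, G.Adj (p i) (p (i + 1))) (a i : ℕ) (ha : a ≤ m) (hi : i < a)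
    (h0a : G.Adj (p 0) (p a)) :
    ∃ I : Finset ℕ, PS G (p i) (p a) (I.image p) ∧ I ⊆ Finset.Icc 0 a ∧ 0 ∈ I ∧
      ∀ l ≤ a, G.Adj (p 0) (p l) → l ∈ I := by
  classical
  have hex : ∃ l, i < l ∧ G.Adj (p 0) (p l) := ⟨a, hi, h0a⟩
  obtain ⟨h1, h2⟩ := Nat.find_spec hex
  have hle : Nat.find hex ≤ a := Nat.find_min' hex ⟨hi, h0a⟩
  have hmin : ∀ l, i < l → G.Adj (p 0) (p l) → Nat.find hex ≤ l :=
    fun l h h' => Nat.find_min' hex ⟨h, h'⟩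
  generalize Nat.find hex = i' at *
  refine ⟨Finset.Icc 0 i ∪ Finset.Icc i' a, ?_, ?_, by simp, ?_⟩
  · rw [Finset.image_union]
    refine (PS.seg' hinj hadj 0 i (by omega) (by omega)).symm.join
      (PS.seg' hinj hadj i' a hle ha) h2 ?_
    intro z hz hz'
    simp only [Finset.mem_image, Finset.mem_Icc] at hz hz'
    obtain ⟨l, hl, rfl⟩ := hz
    obtain ⟨l', hl', he⟩ := hz'
    have := hinj _ (by omega) _ (by omega) he
    omega
  · intro l hl
    simp only [Finset.mem_union, Finset.mem_Icc] at *
    omega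
  · intro l hl hal
    have := hmin l
    simp only [Finset.mem_union, Finset.mem_Icc]
    by_cases h : l ≤ i
    · left; omega
    · right; exact ⟨this (by omega) hal, hl⟩

theorem kop_right {m : ℕ} {p : ℕ → V} (hinj : ∀ i ≤ m, ∀ j ≤ m, p i = p j → i = j)
    (hadj : ∀ i < m, G.Adj (p i) (p (i + 1))) (b j : ℕ) (hj : j ≤ m) (hb : b < j)
    (hmb : G.Adj (p m) (p b)) :
    ∃ I : Finset ℕ, PS G (p j) (p b) (I.image p) ∧ I ⊆ Finset.Icc b m ∧ m ∈ I ∧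
      ∀ l ≤ m, b ≤ l → G.Adj (p m) (p l) → l ∈ I := by
  obtain ⟨I, h1, h2, h3, h4⟩ := kop_left (G := G) (m := m) (p := fun i => p (m - i))
    (by intro i hi j hj h; have := hinj _ (by omega) _ (by omega) h; omega)
    (by
      intro i hi
      have := hadj (m - (i + 1)) (by omega)
      rw [show m - (i + 1) + 1 = m - i by omega] at this
      exact this.symm) (m - b) (m - j) (by omega) (by omega)
    (by simpa [show m - (m - b) = b by omega] using hmb)
  refine ⟨I.image (fun i => m - i), ?_, ?_, ?_, ?_⟩
  · rw [Finset.image_image]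
    simpa [Function.comp_def, show m - (m - b) = b by omega, show m - (m - j) = j by omega] using h1
  · intro l hl
    obtain ⟨i, hi, rfl⟩ := Finset.mem_image.1 hl
    have := h2 hi
    simp only [Finset.mem_Icc] at *
    omega
  · exact Finset.mem_image.2 ⟨0, h3, by simp⟩
  · intro l hl hbl hal
    refine Finset.mem_image.2 ⟨m - l, h4 _ (by omega) ?_, by omega⟩
    simpa [show m - (m - l) = l by omega] using hal

open Classical in
theorem kop_idx (hG : PConn G) {c : ℕ}
    (hNC : ∀ x y S, PS G x y S → G.Adj y x → S.card ≤ c)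
    {m : ℕ} {p : ℕ → V} (hinj : ∀ i ≤ m, ∀ j ≤ m, p i = p j → i = j)
    (hadj : ∀ i < m, G.Adj (p i) (p (i + 1))) (hm : c ≤ m) (hm1 : 1 ≤ m)
    (hd : c + 1 ≤ ((Finset.Icc 0 m).filter (fun l => G.Adj (p 0) (p l))).card +
      ((Finset.Icc 0 m).filter (fun l => G.Adj (p m) (p l))).card) : False := by
  have hcard : ∀ I : Finset ℕ, I ⊆ Finset.Icc 0 m → (I.image p).card = I.card := by
    intro I hI
    apply Finset.card_image_of_injOn
    intro i hi j hj h
    have h1 := Finset.mem_Icc.1 (hI hi)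
    have h2 := Finset.mem_Icc.1 (hI hj)
    exact hinj i h1.2 j h2.2 h
  set Nx := (Finset.Icc 0 m).filter (fun l => G.Adj (p 0) (p l)) with hNx
  set Ny := (Finset.Icc 0 m).filter (fun l => G.Adj (p m) (p l)) with hNy
  have mNx : ∀ l, l ∈ Nx ↔ l ≤ m ∧ G.Adj (p 0) (p l) := by simp [hNx]
  have mNy : ∀ l, l ∈ Ny ↔ l ≤ m ∧ G.Adj (p m) (p l) := by simp [hNy]
  have h0x : 0 ∉ Nx := by simp [mNx]
  have hmy : m ∉ Ny := by simp [mNy]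
  by_cases hcr : ∃ d, 1 ≤ d ∧ ∃ i, i ∈ Ny ∧ i + d ∈ Nx
  · -- crossing neighbours
    obtain ⟨hd1, i, hiy, hjx⟩ := Nat.find_spec hcr
    have hmin : ∀ i j, i < j → i ∈ Ny → j ∈ Nx → Nat.find hcr ≤ j - i := by
      intro i j hij hi hj
      exact Nat.find_min' hcr ⟨by omega, i, hi, by rwa [show i + (j - i) = j by omega]⟩
    generalize Nat.find hcr = d at *
    have hi' := (mNy _).1 hiy
    have hj' := (mNx _).1 hjx
    have hcyc : PS G (p 0) (p (i + d))
        ((Finset.Icc 0 i).image p ∪ (Finset.Icc (i + d) m).image p) := by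
      refine (PS.seg' hinj hadj 0 i (by omega) (by omega)).join
        (PS.seg' hinj hadj (i + d) m hj'.1 le_rfl).symm hi'.2.symm ?_
      intro z hz hz'
      simp only [Finset.mem_image, Finset.mem_Icc] at hz hz'
      obtain ⟨l, hl, rfl⟩ := hz
      obtain ⟨l', hl', he⟩ := hz'
      have := hinj _ (by omega) _ (by omega) he
      omega
    have hle := hNC _ _ _ hcyc hj'.2.symm
    rw [← Finset.image_union, hcard _ (by intro l; simp; omega), Finset.card_union_of_disjoint
      (by rw [Finset.disjoint_left]; intro l; simp; omega)] at hle
    simp only [Nat.card_Icc] at hle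
    have hd2 : 2 ≤ d := by omega
    have hSc : (Nx.image (fun l => l - 1)).card = Nx.card := by
      apply Finset.card_image_of_injOn
      intro a ha b hb h
      have : a ≠ 0 := by rintro rfl; exact h0x ha
      have : b ≠ 0 := by rintro rfl; exact h0x hb
      simp only at h
      omega
    have hdisj : Disjoint (Nx.image (fun l => l - 1)) Ny := by
      rw [Finset.disjoint_left]
      intro l hl hl'
      obtain ⟨a, ha, rfl⟩ := Finset.mem_image.1 hl
      have : a ≠ 0 := by rintro rfl; exact h0x ha
      have := hmin (a - 1) a (by omega) hl' ha
      omega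
    have hsub : Nx.image (fun l => l - 1) ∪ Ny ⊆ Finset.range m \ Finset.Ioo i (i + d - 1) := by
      intro l hl
      rw [Finset.mem_sdiff, Finset.mem_range, Finset.mem_Ioo]
      rcases Finset.mem_union.1 hl with hl | hl
      · obtain ⟨a, ha, rfl⟩ := Finset.mem_image.1 hl
        have : a ≠ 0 := by rintro rfl; exact h0x ha
        have h1 := (mNx _).1 ha
        have h2 := hmin i a
        refine ⟨by omega, fun h => ?_⟩
        have := h2 (by omega) hiy ha
        omega
      · have : l ≠ m := by rintro rfl; exact hmy hl
        have h1 := (mNy _).1 hl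
        have h2 := hmin l (i + d)
        refine ⟨by omega, fun h => ?_⟩
        have := h2 (by omega) hl hjx
        omega
    have hc := Finset.card_le_card hsub
    rw [Finset.card_union_of_disjoint hdisj, hSc, Finset.card_sdiff_of_subset
      (by intro l; simp; omega), Finset.card_range, Nat.card_Ioo] at hc
    omega
  · -- no crossing
    have hnc : ∀ j ∈ Nx, ∀ i ∈ Ny, j ≤ i := by
      intro j hj i hi
      by_contra h
      exact hcr ⟨j - i, by omega, i, hi, by rwa [show i + (j - i) = j by omega]⟩
    have h1x : 1 ∈ Nx := (mNx _).2 ⟨hm1, hadj 0 (by omega)⟩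
    have h1y : m - 1 ∈ Ny := (mNy _).2 ⟨by omega, by
      have := hadj (m - 1) (by omega)
      rw [show m - 1 + 1 = m by omega] at this
      exact this.symm⟩
    obtain ⟨a, haN, hamax⟩ := Finset.exists_max_image Nx id ⟨1, h1x⟩
    obtain ⟨b, hbN, hbmin⟩ := Finset.exists_min_image Ny id ⟨m - 1, h1y⟩
    simp only [id] at hamax hbmin
    have hab := hnc a haN b hbN
    have ha1 := hamax 1 h1x
    have hb1 := hbmin _ h1y
    have ha := (mNx _).1 haN
    have hb := (mNy _).1 hbN
    have hmem : ∀ (i j : ℕ) (l : ℕ), j ≤ m → l ≤ m →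
        (p l ∈ (Finset.Icc i j).image p ↔ i ≤ l ∧ l ≤ j) := by
      intro i j l hj hl
      simp only [Finset.mem_image, Finset.mem_Icc]
      constructor
      · rintro ⟨l', h, he⟩
        have := hinj _ (by omega) _ (by omega) he
        omega
      · intro h; exact ⟨l, h, rfl⟩
    obtain ⟨f, e1, e2, S1, S2, k1, k2, k3, k4, k5, k6, k7, k8, k9, k10, k11⟩ :=
      aug hG ((Finset.Icc 0 a).image p) (p a) ((hmem _ _ _ ha.1 ha.1).2 (by omega))
        ⟨p 0, (hmem _ _ _ ha.1 (by omega)).2 (by omega), ha.2.ne⟩ _ ((Finset.Icc b m).image p)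
        ((Finset.Icc a b).image p) (p b) le_rfl
        (PS.seg' hinj hadj a b hab hb.1) ((hmem _ _ _ le_rfl hb.1).2 (by omega))
        (by
          intro v
          by_cases hv : p b = v
          · exact ⟨p m, (hmem _ _ _ le_rfl le_rfl).2 (by omega), by rw [← hv]; exact hb.2.ne⟩
          · exact ⟨p b, (hmem _ _ _ le_rfl hb.1).2 (by omega), hv⟩)
        (by
          intro z hz hz'
          obtain ⟨l, hl, rfl⟩ := Finset.mem_image.1 hz
          rw [Finset.mem_Icc] at hl
          have := (hmem _ _ _ ha.1 (by omega)).1 hz'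
          rw [show l = a by omega])
        (by
          intro z hz hz'
          obtain ⟨l, hl, rfl⟩ := Finset.mem_image.1 hz
          rw [Finset.mem_Icc] at hl
          have := (hmem _ _ _ le_rfl (by omega)).1 hz'
          rw [show l = b by omega])
    have m1l := k1.left_mem
    have m1r := k1.right_mem
    have m2l := k2.left_mem
    have m2r := k2.right_mem
    have hfa : f ≠ p a := by rintro rfl; exact k10 _ m1l m2l
    have he12 : e1 ≠ e2 := by rintro rfl; exact k10 _ m1r m2r
    obtain ⟨i, hi, rfl⟩ := Finset.mem_image.1 k3
    rw [Finset.mem_Icc] at hi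
    have hia : i ≠ a := by rintro rfl; exact hfa rfl
    obtain ⟨IL, l1, l2, l3, l4⟩ := kop_left hinj hadj a i ha.1 (by omega) ha.2
    have hR : ∃ I : Finset ℕ, PS G e1 e2 (I.image p) ∧ I ⊆ Finset.Icc b m ∧ m ∈ I ∧
        ∀ l ≤ m, b ≤ l → G.Adj (p m) (p l) → l ∈ I := by
      rcases k11 with rfl | rfl
      · obtain ⟨j, hj, rfl⟩ := Finset.mem_image.1 k5
        rw [Finset.mem_Icc] at hj
        have : j ≠ b := by rintro rfl; exact he12 rfl
        obtain ⟨I, r1, r2⟩ := kop_right hinj hadj b j hj.2 (by omega) hb.2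
        exact ⟨I, r1.symm, r2⟩
      · obtain ⟨j, hj, rfl⟩ := Finset.mem_image.1 k4
        rw [Finset.mem_Icc] at hj
        have : j ≠ b := by rintro rfl; exact he12 rfl
        exact kop_right hinj hadj b j hj.2 (by omega) hb.2
    obtain ⟨IR, r1, r2, r3, r4⟩ := hR
    have hLA : IL.image p ⊆ (Finset.Icc 0 a).image p := Finset.image_subset_image l2
    have hRB : IR.image p ⊆ (Finset.Icc b m).image p := Finset.image_subset_image r2
    have hAB : ∀ z ∈ (Finset.Icc 0 a).image p, z ∈ (Finset.Icc b m).image p → z = p a := by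
      intro z hz hz'
      obtain ⟨l, hl, rfl⟩ := Finset.mem_image.1 hz
      rw [Finset.mem_Icc] at hl
      have := (hmem _ _ _ le_rfl (by omega)).1 hz'
      rw [show l = a by omega]
    have w1 := l1.trans k1 (fun z hz hz' => k6 z hz' (hLA hz))
    have w2 := w1.trans r1 (by
      intro z hz hz'
      rcases Finset.mem_union.1 hz with hz | hz
      · have := hAB z (hLA hz) (hRB hz')
        subst this
        exact k8 _ m1l (hRB hz')
      · exact k8 z hz (hRB hz'))
    have hfe : p i ≠ e2 := by
      rintro rfl
      have := (hmem _ _ _ le_rfl (by omega)).1 k5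
      omega
    obtain ⟨z, hz1, hz2⟩ := w2.close k2 hfe (by
      intro z hz hz'
      rcases Finset.mem_union.1 hz with hz | hz
      · rcases Finset.mem_union.1 hz with hz | hz
        · exact Or.inl (k7 z hz' (hLA hz))
        · exact absurd hz' (k10 z hz)
      · exact Or.inr (k9 z hz' (hRB hz)))
    have hfin := hNC _ _ _ hz1 hz2
    have hsub : (insert 0 Nx ∪ insert m Ny).image p ⊆
        IL.image p ∪ S1 ∪ IR.image p ∪ S2 := by
      intro z hz
      obtain ⟨l, hl, rfl⟩ := Finset.mem_image.1 hz
      rcases Finset.mem_union.1 hl with hl | hl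
      · have : l ∈ IL := by
          rcases Finset.mem_insert.1 hl with rfl | hl
          · exact l3
          · exact l4 l (hamax l hl) ((mNx l).1 hl).2
        have := Finset.mem_image_of_mem p this
        simp only [Finset.mem_union]; tauto
      · have : l ∈ IR := by
          rcases Finset.mem_insert.1 hl with rfl | hl
          · exact r3
          · exact r4 l ((mNy l).1 hl).1 (hbmin l hl) ((mNy l).1 hl).2
        have := Finset.mem_image_of_mem p this
        simp only [Finset.mem_union]; tauto
    have hc1 := Finset.card_le_card hsub
    rw [hcard _ (by
      intro l hl
      have h1 := mNx l
      have h2 := mNy l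
      simp only [Finset.mem_union, Finset.mem_insert] at hl
      rw [Finset.mem_Icc]
      rcases hl with (rfl | hl) | (rfl | hl)
      · omega
      · have := (h1.1 hl).1; omega
      · omega
      · have := (h2.1 hl).1; omega)] at hc1
    have hc2 := Finset.card_union_add_card_inter (insert 0 Nx) (insert m Ny)
    rw [Finset.card_insert_of_notMem h0x, Finset.card_insert_of_notMem hmy] at hc2
    have hc3 : (insert 0 Nx ∩ insert m Ny).card ≤ 1 := by
      rw [Finset.card_le_one]
      have : ∀ l ∈ insert 0 Nx ∩ insert m Ny, l = a := by
        intro l hl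
        simp only [Finset.mem_inter, Finset.mem_insert] at hl
        have h1 := hamax l
        have h2 := hbmin l
        rcases hl with ⟨rfl | hl, rfl | hl'⟩
        · omega
        · have := h2 hl'; omega
        · have := h1 hl; omega
        · have := h1 hl; have := h2 hl'; omega
      intro l hl l' hl'
      rw [this l hl, this l' hl']
    omega

open Classical in
theorem kopylov (hG : PConn G) {c : ℕ} (hc : 1 ≤ c)
    (hNC : ∀ x y S, PS G x y S → G.Adj y x → S.card ≤ c)
    {x y : V} {S : Finset V} (hP : PS G x y S) (hS : c + 1 ≤ S.card)
    (hd : c + 1 ≤ (S.filter (fun w => G.Adj x w)).card + (S.filter (fun w => G.Adj y w)).card) :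
    False := by
  obtain ⟨m, p, rfl, rfl, rfl, hinj, hadj⟩ := hP.index
  have hm : ((Finset.Icc 0 m).image p).card ≤ m + 1 := by
    refine Finset.card_image_le.trans ?_
    simp
  refine kop_idx hG hNC hinj hadj (by omega) (by omega) (hd.trans ?_)
  rw [Finset.filter_image, Finset.filter_image]
  exact Nat.add_le_add Finset.card_image_le Finset.card_image_le

end Kopylov

/-! ### Edge-maximal supergraphs -/

section Maximal

variable {V : Type} [DecidableEq V] {G : SimpleGraph V}

/-- No cycle on more than `c` vertices. -/
def NoLong (G : SimpleGraph V) (c : ℕ) : Prop :=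
  ∀ x y S, PS G x y S → G.Adj y x → S.card ≤ c

/-- Paths in `G + uv`. -/
theorem PS.of_edge {u v x y : V} {S : Finset V} (h : PS (G ⊔ edge u v) x y S) :
    PS G x y S ∨ ∃ u' v' S1 S2, ((u' = u ∧ v' = v) ∨ (u' = v ∧ v' = u)) ∧
      PS G x u' S1 ∧ PS G v' y S2 ∧ (∀ z ∈ S1, z ∉ S2) ∧ S = S1 ∪ S2 := by
  induction h with
  | nil x S h => exact Or.inl (PS.nil x S h)
  | cons z x y S T ha hz hp hT ih =>
    subst hT
    rcases ih with ih | ⟨u', v', S1, S2, huv, h1, h2, h3, h4⟩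
    · rw [sup_adj, edge_adj] at ha
      rcases ha with ha | ⟨ha, -⟩
      · exact Or.inl (PS.cons z x y S _ ha hz ih rfl)
      · right
        exact ⟨z, x, {z}, S, by tauto, PS.nil z _ rfl, ih, by simpa using hz, by ext; simp⟩
    · right
      subst h4
      rw [sup_adj, edge_adj] at ha
      rcases ha with ha | ⟨ha, -⟩
      · exact ⟨u', v', insert z S1, S2, huv, PS.cons z x u' S1 _ ha (by grind) h1 rfl, h2,
          by grind, by ext; simp⟩
      · exfalso
        have i1 := h1.left_mem
        have i2 := h1.right_mem
        have i3 := h2.left_mem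
        grind

theorem maximal_path {c : ℕ} (hc : 2 ≤ c) (hNC : NoLong G c)
    (hmax : ∀ H : SimpleGraph V, G ≤ H → NoLong H c → H ≤ G) (u v : V) (huv : u ≠ v)
    (hna : ¬ G.Adj u v) : ∃ S, PS G u v S ∧ c + 1 ≤ S.card := by
  have h1 : ¬ NoLong (G ⊔ edge u v) c := by
    intro h
    have := hmax _ le_sup_left h
    exact hna (this (by rw [sup_adj, edge_adj]; right; exact ⟨Or.inl ⟨rfl, rfl⟩, huv⟩))
  unfold NoLong at h1
  push Not at h1
  obtain ⟨x, y, S, hS, ha, hcS⟩ := h1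
  rw [sup_adj, edge_adj] at ha
  rcases hS.of_edge with h | ⟨u', v', S1, S2, huv', h1, h2, h3, h4⟩
  · rcases ha with ha | ⟨ha, -⟩
    · have := hNC _ _ _ h ha; omega
    · rcases ha with ⟨rfl, rfl⟩ | ⟨rfl, rfl⟩
      · exact ⟨S, h.symm, hcS⟩
      · exact ⟨S, h, hcS⟩
  · rcases ha with ha | ⟨ha, -⟩
    · have := h2.join h1 ha (by grind)
      rw [Finset.union_comm, ← h4] at this
      rcases huv' with ⟨rfl, rfl⟩ | ⟨rfl, rfl⟩
      · exact ⟨S, this.symm, hcS⟩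
      · exact ⟨S, this, hcS⟩
    · exfalso
      have i1 := h1.left_mem
      have i2 := h1.right_mem
      have i3 := h2.left_mem
      have i4 := h2.right_mem
      have e1 : x = u' := by grind
      have e2 : v' = y := by grind
      have j1 := h1.eq_singleton e1
      have j2 := h2.eq_singleton e2
      have : S.card ≤ 2 := by
        rw [h4, j1, j2]
        exact (Finset.card_union_le _ _).trans (by simp)
      omega

theorem exists_maximal [Fintype V] {c : ℕ} (hNC : NoLong G c) : ∃ G' : SimpleGraph V, G ≤ G' ∧
    NoLong G' c ∧ ∀ H : SimpleGraph V, G' ≤ H → NoLong H c → H ≤ G' := by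
  classical
  obtain ⟨G', h1, h2⟩ := (Set.toFinite {H : SimpleGraph V | NoLong H c}).exists_le_maximal
    (a := G) hNC
  exact ⟨G', h1, h2.1, fun H hH hN => h2.2 hN hH⟩

theorem PConn.mono {G' : SimpleGraph V} (h : PConn G) (hle : G ≤ G') : PConn G' := by
  intro v x y hx hy
  obtain ⟨S, hS, hv⟩ := h v x y hx hy
  exact ⟨S, hS.mono hle, hv⟩

open Classical in
/-- The longest path argument. -/
theorem all_adj [Fintype V] {c : ℕ} (hc : 2 ≤ c) (hG : PConn G) (hNC : NoLong G c)
    (hmax : ∀ H : SimpleGraph V, G ≤ H → NoLong H c → H ≤ G) (H Z : Finset V) (dx dy : ℕ)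
    (hH : ∀ x ∈ H, dx ≤ (H.filter (fun w => G.Adj x w)).card)
    (hZ : ∀ y ∈ Z, dy ≤ (Z.filter (fun w => G.Adj y w)).card) (hd : c + 1 ≤ dx + dy) :
    ∀ x ∈ H, ∀ y ∈ Z, x ≠ y → G.Adj x y := by
  by_contra hcon
  push Not at hcon
  obtain ⟨x0, hx0, y0, hy0, hne0, hna0⟩ := hcon
  obtain ⟨S0, hS0, hS0c⟩ := maximal_path hc hNC hmax x0 y0 hne0 hna0
  obtain ⟨S, hS, hSmax⟩ := Finset.exists_max_image
    (Finset.univ.filter (fun S : Finset V => ∃ x ∈ H, ∃ y ∈ Z, x ≠ y ∧ ¬ G.Adj x y ∧ PS G x y S))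
    Finset.card ⟨S0, by simp only [Finset.mem_filter, Finset.mem_univ, true_and];
                        exact ⟨x0, hx0, y0, hy0, hne0, hna0, hS0⟩⟩
  simp only [Finset.mem_filter, Finset.mem_univ, true_and] at hS hSmax
  have hSc := hSmax S0 ⟨x0, hx0, y0, hy0, hne0, hna0, hS0⟩
  obtain ⟨x, hx, y, hy, hne, hna, hP⟩ := hS
  have hxS := hP.left_mem
  have hyS := hP.right_mem
  refine kopylov hG (by omega) hNC hP (by omega) (hd.trans (Nat.add_le_add ?_ ?_))
  · refine (hH x hx).trans (Finset.card_le_card ?_)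
    intro w hw
    rw [Finset.mem_filter] at hw ⊢
    refine ⟨?_, hw.2⟩
    by_contra hwS
    have hP' : PS G w y (insert w S) := PS.cons w x y S _ hw.2.symm hwS hP rfl
    have hcard := Finset.card_insert_of_notMem hwS
    by_cases hwy : G.Adj y w
    · have := hNC _ _ _ hP' hwy
      omega
    · have := hSmax (insert w S) ⟨w, hw.1, y, hy, by rintro rfl; exact hwS hyS,
        fun h => hwy h.symm, hP'⟩
      omega
  · refine (hZ y hy).trans (Finset.card_le_card ?_)
    intro w hw
    rw [Finset.mem_filter] at hw ⊢
    refine ⟨?_, hw.2⟩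
    by_contra hwS
    have hP' : PS G x w (insert w S) := (PS.cons w y x S _ hw.2.symm hwS hP.symm rfl).symm
    have hcard := Finset.card_insert_of_notMem hwS
    by_cases hwx : G.Adj w x
    · have := hNC _ _ _ hP' hwx
      omega
    · have := hSmax (insert w S) ⟨x, hx, w, hw.1, by rintro rfl; exact hwS hxS,
        fun h => hwx h.symm, hP'⟩
      omega

theorem clique_path (H : Finset V) (hH : ∀ x ∈ H, ∀ y ∈ H, x ≠ y → G.Adj x y) :
    ∀ x ∈ H, ∃ y, PS G x y H := by
  induction hn : H.card generalizing H with
  | zero => intro x hx; rw [Finset.card_eq_zero] at hn; simp [hn] at hx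
  | succ n ih =>
    intro x hx
    have hcard := Finset.card_erase_of_mem hx
    by_cases he : (H.erase x).Nonempty
    · obtain ⟨z, hz⟩ := he
      obtain ⟨y, hy⟩ := ih (H.erase x) (by grind) (by omega) z hz
      exact ⟨y, PS.cons x z y _ _ (hH x hx z (by grind) (by grind)) (by simp) hy
        (Finset.insert_erase hx).symm⟩
    · rw [Finset.not_nonempty_iff_eq_empty] at he
      exact ⟨x, PS.nil x _ (by rw [← Finset.insert_erase hx, he]; rfl)⟩

end Maximal

/-! ### Cores -/

section Core

variable {V : Type} [DecidableEq V] [Fintype V]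

open Classical in
/-- The `t`-core: what remains after recursively deleting vertices of degree at most `t`. -/
noncomputable def core (G : SimpleGraph V) (t : ℕ) : Finset V :=
  Finset.univ.filter (fun v => ∃ W : Finset V, v ∈ W ∧
    ∀ w ∈ W, t + 1 ≤ (W.filter (fun z => G.Adj w z)).card)

open Classical in
theorem core_max (G : SimpleGraph V) (t : ℕ) (W : Finset V)
    (h : ∀ w ∈ W, t + 1 ≤ (W.filter (fun z => G.Adj w z)).card) : W ⊆ core G t := by
  intro v hv
  simp only [core, Finset.mem_filter, Finset.mem_univ, true_and]
  exact ⟨W, hv, h⟩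

open Classical in
theorem core_deg (G : SimpleGraph V) (t : ℕ) (v : V) (hv : v ∈ core G t) :
    t + 1 ≤ ((core G t).filter (fun z => G.Adj v z)).card := by
  have := hv
  simp only [core, Finset.mem_filter, Finset.mem_univ, true_and] at this
  obtain ⟨W, hvW, hW⟩ := this
  exact (hW v hvW).trans (Finset.card_le_card (Finset.filter_subset_filter _ (core_max G t W hW)))

theorem core_mono {G G' : SimpleGraph V} (h : G ≤ G') (t : ℕ) : core G t ⊆ core G' t := by
  classical
  apply core_max
  intro w hw
  refine (core_deg G t w hw).trans (Finset.card_le_card ?_)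
  intro z hz
  rw [Finset.mem_filter] at *
  exact ⟨hz.1, h hz.2⟩

theorem core_anti (G : SimpleGraph V) {s t : ℕ} (h : s ≤ t) : core G t ⊆ core G s := by
  classical
  apply core_max
  intro w hw
  have := core_deg G t w hw
  omega

theorem core_card (G : SimpleGraph V) (t : ℕ) (h : (core G t).Nonempty) :
    t + 2 ≤ (core G t).card := by
  classical
  obtain ⟨v, hv⟩ := h
  have h1 := core_deg G t v hv
  have h2 : ((core G t).filter (fun z => G.Adj v z)).card < (core G t).card := by
    apply Finset.card_lt_card
    rw [Finset.ssubset_iff_of_subset (Finset.filter_subset _ _)]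
    exact ⟨v, hv, by simp⟩
  omega

/-- A vertex joined to a whole nonempty core belongs to it. -/
theorem core_join (G : SimpleGraph V) (t : ℕ) (h : (core G t).Nonempty) (y : V)
    (hy : ∀ x ∈ core G t, x ≠ y → G.Adj x y) : y ∈ core G t := by
  classical
  by_contra hyc
  have hcard := core_card G t h
  have : insert y (core G t) ⊆ core G t := by
    apply core_max
    intro w hw
    rcases Finset.mem_insert.1 hw with rfl | hw
    · refine le_trans (by omega) (Finset.card_le_card (s := core G t) ?_)
      intro z hz
      rw [Finset.mem_filter]
      exact ⟨Finset.mem_insert_of_mem hz, (hy z hz (by rintro rfl; exact hyc hz)).symm⟩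
    · exact (core_deg G t w hw).trans (Finset.card_le_card
        (Finset.filter_subset_filter _ (Finset.subset_insert _ _)))
  exact hyc (this (Finset.mem_insert_self _ _))

open Classical in
theorem core_peel (G : SimpleGraph V) (t : ℕ) (W : Finset V) (h : (W \ core G t).Nonempty) :
    ∃ v ∈ W \ core G t, (W.filter (fun z => G.Adj v z)).card ≤ t := by
  by_contra hcon
  push Not at hcon
  have : W ∪ core G t ⊆ core G t := by
    apply core_max
    intro w hw
    by_cases hwc : w ∈ core G t
    · exact (core_deg G t w hwc).trans (Finset.card_le_card
        (Finset.filter_subset_filter _ Finset.subset_union_right))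
    · refine le_trans (hcon w (by grind)) (Finset.card_le_card
        (Finset.filter_subset_filter _ Finset.subset_union_left))
  obtain ⟨v, hv⟩ := h
  grind

end Core

/-! ### Counting cliques -/

section Count

variable {V : Type} [DecidableEq V]

open Classical in
/-- Number of `s`-cliques inside `W`. -/
noncomputable def cl (G : SimpleGraph V) (s : ℕ) (W : Finset V) : ℕ :=
  ((W.powersetCard s).filter (fun S : Finset V => G.IsClique (S : Set V))).card

theorem cl_le_choose (G : SimpleGraph V) (s : ℕ) (W : Finset V) :
    cl G s W ≤ W.card.choose s := by
  classical
  rw [← Finset.card_powersetCard]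
  exact Finset.card_le_card (Finset.filter_subset _ _)

open Classical in
theorem cl_erase (G : SimpleGraph V) (s : ℕ) (hs : 1 ≤ s) (W : Finset V) (v : V) (d : ℕ)
    (hd : (W.filter (fun z => G.Adj v z)).card ≤ d) :
    cl G s W ≤ cl G s (W.erase v) + d.choose (s - 1) := by
  have hsub : (W.powersetCard s).filter (fun S : Finset V => G.IsClique (S : Set V)) ⊆
      ((W.erase v).powersetCard s).filter (fun S : Finset V => G.IsClique (S : Set V)) ∪
      ((W.filter (fun z => G.Adj v z)).powersetCard (s - 1)).image (fun S : Finset V => insert v S) := by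
    intro S hS
    rw [Finset.mem_filter, Finset.mem_powersetCard] at hS
    obtain ⟨⟨hSW, hSc⟩, hcl⟩ := hS
    rw [Finset.mem_union]
    by_cases hv : v ∈ S
    · right
      rw [Finset.mem_image]
      refine ⟨S.erase v, ?_, Finset.insert_erase hv⟩
      rw [Finset.mem_powersetCard, Finset.card_erase_of_mem hv]
      refine ⟨?_, by omega⟩
      intro z hz
      rw [Finset.mem_erase] at hz
      rw [Finset.mem_filter]
      exact ⟨hSW hz.2, hcl (by exact_mod_cast hv) (by exact_mod_cast hz.2) hz.1.symm⟩
    · left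
      rw [Finset.mem_filter, Finset.mem_powersetCard]
      refine ⟨⟨?_, hSc⟩, hcl⟩
      intro z hz
      rw [Finset.mem_erase]
      exact ⟨by rintro rfl; exact hv hz, hSW hz⟩
  refine (Finset.card_le_card hsub).trans ((Finset.card_union_le _ _).trans ?_)
  refine Nat.add_le_add_left ?_ _
  refine Finset.card_image_le.trans ?_
  rw [Finset.card_powersetCard]
  exact Nat.choose_le_choose _ hd

open Classical in
theorem cl_sdiff (G : SimpleGraph V) (s : ℕ) (hs : 1 ≤ s) (d : ℕ) (Q : Finset V) :
    ∀ W : Finset V, (∀ v ∈ Q, (W.filter (fun z => G.Adj v z)).card ≤ d) →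
    cl G s W ≤ cl G s (W \ Q) + Q.card * d.choose (s - 1) := by
  induction Q using Finset.induction_on with
  | empty => intro W _; simp
  | insert v Q hv ih =>
    intro W hW
    have h1 := cl_erase G s hs W v d (hW v (by simp))
    have h2 := ih (W.erase v) (fun w hw => (Finset.card_le_card (Finset.filter_subset_filter _
      (Finset.erase_subset _ _))).trans (hW w (by simp [hw])))
    rw [show W.erase v \ Q = W \ insert v Q by grind] at h2
    rw [Finset.card_insert_of_notMem hv, Nat.succ_mul]
    omega

theorem cl_peel [Fintype V] {G G' : SimpleGraph V} (hle : G ≤ G') (s : ℕ) (hs : 1 ≤ s) (t : ℕ)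
    (W : Finset V) :
    cl G s W ≤ cl G s (W ∩ core G' t) + (W \ core G' t).card * t.choose (s - 1) := by
  classical
  induction hn : (W \ core G' t).card generalizing W with
  | zero =>
    rw [Finset.card_eq_zero, Finset.sdiff_eq_empty_iff_subset] at hn
    rw [Finset.inter_eq_left.2 hn]
    simp
  | succ n ih =>
    obtain ⟨v, hv, hvd⟩ := core_peel G' t W (Finset.card_pos.1 (by omega))
    have h1 := cl_erase G s hs W v t (le_trans (Finset.card_le_card (by
      intro z hz
      rw [Finset.mem_filter] at *
      exact ⟨hz.1, hle hz.2⟩)) hvd)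
    have h2 := ih (W.erase v) (by
      rw [show W.erase v \ core G' t = (W \ core G' t).erase v by grind,
        Finset.card_erase_of_mem hv]
      omega)
    rw [show W.erase v ∩ core G' t = W ∩ core G' t by grind] at h2
    rw [Nat.succ_mul]
    omega

theorem cl_empty_core [Fintype V] {G : SimpleGraph V} (s : ℕ) (hs : 1 ≤ s) (t r : ℕ)
    (he : core G t = ∅) (d : ℕ) (W : Finset V) (hW : W.card = r + d) :
    cl G s W ≤ r.choose s + d * t.choose (s - 1) := by
  classical
  induction d generalizing W with
  | zero => simpa [hW] using cl_le_choose G s W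
  | succ d ih =>
    obtain ⟨v, hv, hvd⟩ := core_peel G t W (by
      rw [he, Finset.sdiff_empty]; exact Finset.card_pos.1 (by omega))
    have h1 := cl_erase G s hs W v t hvd
    have h2 := ih (W.erase v) (by
      rw [Finset.card_erase_of_mem (Finset.mem_sdiff.1 hv).1]; omega)
    rw [Nat.succ_mul]
    omega

end Count

/-! ### Arithmetic -/

theorem choose_swap (s j x q : ℕ) (hs : 1 ≤ s) (hx : j ≤ x) :
    x.choose s + q * j.choose (s - 1) ≤ (x + q).choose s := by
  induction q with
  | zero => simp
  | succ q ih =>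
    obtain ⟨s, rfl⟩ := Nat.exists_eq_add_of_le' hs
    have := Nat.choose_le_choose s (show j ≤ x + q by omega)
    rw [← Nat.add_assoc, Nat.choose_succ_succ', Nat.succ_mul]
    simp only [Nat.add_sub_cancel] at *
    omega

/-- A discretely convex function is bounded by its values at the ends. -/
theorem convex_max (F : ℕ → ℤ) (a b : ℕ)
    (h : ∀ i, a ≤ i → i + 2 ≤ b → F (i + 1) - F i ≤ F (i + 2) - F (i + 1)) (j : ℕ) (haj : a ≤ j)
    (hjb : j ≤ b) : F j ≤ max (F a) (F b) := by
  by_cases hup : ∃ i, a ≤ i ∧ i + 1 ≤ j ∧ F i < F (i + 1)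
  · obtain ⟨i, hi, hij, hlt⟩ := hup
    have hinc : ∀ d, i + d + 1 ≤ b → F (i + d) < F (i + d + 1) := by
      intro d
      induction d with
      | zero => intro _; exact hlt
      | succ d ih =>
        intro hb
        have h1 := ih (by omega)
        have h2 := h (i + d) (by omega) (by omega)
        have : F (i + d + 1) < F (i + d + 2) := by omega
        exact this
    have hmono : ∀ d, j + d ≤ b → F j ≤ F (j + d) := by
      intro d
      induction d with
      | zero => intro _; exact le_rfl
      | succ d ih =>
        intro hb
        have h1 := ih (by omega)
        have h2 := hinc (j + d - i) (by omega)
        rw [show i + (j + d - i) = j + d by omega] at h2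
        rw [← Nat.add_assoc]
        omega
    have := hmono (b - j) (by omega)
    rw [show j + (b - j) = b by omega] at this
    exact this.trans (le_max_right _ _)
  · push Not at hup
    have hmono : ∀ d, a + d ≤ j → F (a + d) ≤ F a := by
      intro d
      induction d with
      | zero => intro _; exact le_rfl
      | succ d ih =>
        intro hb
        have h1 := ih (by omega)
        have h2 := hup (a + d) (by omega) (by omega)
        rw [← Nat.add_assoc]
        omega
    have := hmono (j - a) (by omega)
    rw [show a + (j - a) = j by omega] at this
    exact this.trans (le_max_left _ _)

theorem arith (n c k s q j : ℕ) (hn : c + 1 ≤ n) (hq : q ≤ k) (hkc : 2 * k ≤ c) (hs : 2 ≤ s)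
    (hkj : k ≤ j) (hjt : j ≤ c / 2) :
    q * k.choose (s - 1) + (n + j - q - c - 1) * j.choose (s - 1) + (c + 1 - j).choose s ≤
      max (fCliques n c k s) (gCliquesQ n c k q s) := by
  obtain ⟨s, rfl⟩ := Nat.exists_eq_add_of_le' hs
  have hmain := convex_max (fun i => ((q * k.choose (s + 1) + (n + i - q - c - 1) *
    i.choose (s + 1) + (c + 1 - i).choose (s + 2) : ℕ) : ℤ)) k (c / 2) ?_ j hkj hjt
  · have e1 : fCliques n c k (s + 2) = q * k.choose (s + 1) + (n + k - q - c - 1) *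
        k.choose (s + 1) + (c + 1 - k).choose (s + 2) := by
      unfold fCliques
      obtain ⟨A, hA⟩ : ∃ A, n + k - q - c - 1 = A := ⟨_, rfl⟩
      rw [hA, show n + k - c - 1 = q + A by omega, show s + 2 - 1 = s + 1 by omega]
      ring
    have e2 : gCliquesQ n c k q (s + 2) = q * k.choose (s + 1) + (n + c / 2 - q - c - 1) *
        (c / 2).choose (s + 1) + (c + 1 - c / 2).choose (s + 2) := rfl
    rw [e1, e2]
    exact_mod_cast hmain
  · intro i hi hib
    obtain ⟨A, hA⟩ : ∃ A, n + i - q - c - 1 = A := ⟨_, rfl⟩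
    obtain ⟨B, hB⟩ : ∃ B, c + 1 - (i + 2) = B := ⟨_, rfl⟩
    rw [hA, show n + (i + 1) - q - c - 1 = A + 1 by omega,
      show n + (i + 2) - q - c - 1 = A + 2 by omega, hB,
      show c + 1 - (i + 1) = B + 1 by omega, show c + 1 - i = B + 2 by omega]
    have c1 := Nat.choose_succ_succ' i s
    have c2 := Nat.choose_succ_succ' (i + 1) s
    have c3 : i.choose s ≤ (i + 1).choose s := Nat.choose_le_choose s (by omega)
    have c4 := Nat.choose_succ_succ' B (s + 1)
    have c5 := Nat.choose_succ_succ' (B + 1) (s + 1)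
    have c6 : B.choose (s + 1) ≤ (B + 1).choose (s + 1) := Nat.choose_le_choose _ (by omega)
    simp only [Nat.add_assoc, Nat.reduceAdd] at c1 c2 c3 c4 c5 c6 ⊢
    rw [c5, c4, c2, c1]
    push_cast
    have c3' : (i.choose s : ℤ) ≤ (i + 1).choose s := by exact_mod_cast c3
    have c6' : (B.choose (s + 1) : ℤ) ≤ (B + 1).choose (s + 1) := by exact_mod_cast c6
    have hA0 : (0 : ℤ) ≤ A := by positivity
    have hp : (0 : ℤ) ≤ i.choose s := by positivity
    nlinarith [mul_le_mul_of_nonneg_left c3' hA0]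

/-! ### Translation from the notions in the statement -/

theorem PS.walk {V : Type} [DecidableEq V] {G : SimpleGraph V} {x y : V} {S : Finset V}
    (h : PS G x y S) : ∃ w : G.Walk x y, w.IsPath ∧ w.length + 1 = S.card ∧ ∀ z ∈ w.support, z ∈ S
    := by
  induction h with
  | nil x S h => exact ⟨Walk.nil, by simp, by simp [h], by simp [h]⟩
  | cons z x y S T ha hz hp hT ih =>
    obtain ⟨w, h1, h2, h3⟩ := ih
    refine ⟨Walk.cons ha w, ?_, ?_, ?_⟩
    · rw [Walk.cons_isPath_iff]
      exact ⟨h1, fun h => hz (h3 _ h)⟩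
    · rw [hT, Finset.card_insert_of_notMem hz, Walk.length_cons, h2]
    · intro u hu
      rw [Walk.support_cons, List.mem_cons] at hu
      rw [hT, Finset.mem_insert]
      exact hu.imp id (h3 u)

theorem noLong_of_circ {V : Type} [DecidableEq V] [Fintype V] (G : SimpleGraph V) {c : ℕ}
    (hc : 2 ≤ c) (h : circ G = c) : NoLong G c := by
  intro x y S hS ha
  by_contra hlt
  obtain ⟨w, h1, h2, -⟩ := hS.walk
  have hcyc : (Walk.cons ha w).IsCycle := by
    rw [Walk.cons_isCycle_iff]
    refine ⟨h1, ?_⟩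
    cases w with
    | nil => simp
    | @cons _ z _ h' w' =>
      rw [Walk.cons_isPath_iff] at h1
      intro he
      rw [Walk.edges_cons, List.mem_cons] at he
      rcases he with he | he
      · have hyz : y = z := by
          rw [Sym2.eq_iff] at he
          rcases he with ⟨e, -⟩ | ⟨e, -⟩
          · exact absurd e ha.ne
          · exact e
        subst hyz
        have := (Walk.isPath_iff_nil.1 h1.1).eq_nil
        subst this
        simp at h2
        omega
      · exact h1.2 (Walk.snd_mem_support_of_mem_edges _ he)
  have hbdd : BddAbove {n | ∃ (v : V) (w : G.Walk v v), w.IsCycle ∧ w.length = n} := by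
    refine ⟨Fintype.card V, ?_⟩
    rintro n ⟨v, w, hw, rfl⟩
    have := hw.support_nodup.length_le_card
    simpa using this
  have := le_csSup hbdd ⟨y, _, hcyc, rfl⟩
  unfold circ at h
  rw [h, Walk.length_cons] at this
  omega

theorem pconn_of_twoConnected {V : Type} [DecidableEq V] (G : SimpleGraph V)
    (h : TwoConnected G) : PConn G := by
  intro v x y hx hy
  obtain ⟨w⟩ := (h.2 v).preconnected ⟨x, hx⟩ ⟨y, hy⟩
  have key : ∀ (a b : {u | u ≠ v}) (w : (G.induce {u | u ≠ v}).Walk a b),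
      ∃ S, PS G a b S ∧ v ∉ S := by
    intro a b w
    induction w with
    | @nil a => exact ⟨{a.1}, PS.nil _ _ rfl, by simpa using fun e => a.2 e.symm⟩
    | @cons a b d hab w ih =>
      obtain ⟨S, hS, hv⟩ := ih
      by_cases ha : a.1 ∈ S
      · obtain ⟨S1, S2, h1, h2, h3, h4⟩ := hS.split _ ha
        exact ⟨S2, h2, by grind⟩
      · refine ⟨insert a.1 S, PS.cons _ _ _ S _ hab ha hS rfl, ?_⟩
        rw [Finset.mem_insert]
        rintro (e | e)
        · exact a.2 e.symm
        · exact hv e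
  exact key _ _ w

open Classical in
theorem main_bound {V : Type} [Fintype V] (n c k s q : ℕ) (h1 : c + 1 ≤ n)
    (h2 : 2 * k ≤ c) (h3 : 2 ≤ k) (h4 : 2 ≤ s) (h6 : q ≤ k)
    (G : SimpleGraph V) (hV : Fintype.card V = n) (hconn : PConn G) (hNC : NoLong G c)
    (hdeg : ∀ v, k ≤ (Finset.univ.filter (fun z => G.Adj v z)).card)
    (Q : Finset V) (hQ : Q.card = q)
    (hQd : ∀ v ∈ Q, (Finset.univ.filter (fun z => G.Adj v z)).card = k) :
    cl G s Finset.univ ≤ max (fCliques n c k s) (gCliquesQ n c k q s) := by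
  have hst := cl_sdiff G s (by omega) k Q Finset.univ (fun v hv => (hQd v hv).le)
  rw [hQ] at hst
  have hWc : (Finset.univ \ Q).card = n - q := by
    rw [Finset.card_sdiff_of_subset (Finset.subset_univ _), Finset.card_univ, hV, hQ]
  by_cases he : core G (c / 2) = ∅
  · have h := cl_empty_core s (by omega) (c / 2) (c + 1 - c / 2) he (n + c / 2 - q - c - 1)
      (Finset.univ \ Q) (by omega)
    refine le_trans ?_ (le_max_right _ _)
    unfold gCliquesQ
    omega
  · have hne := Finset.nonempty_iff_ne_empty.2 he
    obtain ⟨G', hle, hNC', hmax⟩ := exists_maximal hNC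
    have hconn' := hconn.mono hle
    have hH0 := core_card G (c / 2) hne
    have hsub := core_mono hle (c / 2)
    have hneH := hne.mono hsub
    obtain ⟨r, hr⟩ : ∃ r, (core G' (c / 2)).card = r := ⟨_, rfl⟩
    have hclq := all_adj (by omega) hconn' hNC' hmax (core G' (c / 2)) (core G' (c / 2))
      (c / 2 + 1) (c / 2 + 1) (core_deg G' _) (core_deg G' _) (by omega)
    have hHd : ∀ x ∈ core G' (c / 2),
        r - 1 ≤ ((core G' (c / 2)).filter (fun w => G'.Adj x w)).card := by
      intro x hx
      rw [← hr, ← Finset.card_erase_of_mem hx]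
      apply Finset.card_le_card
      intro z hz
      rw [Finset.mem_erase] at hz
      rw [Finset.mem_filter]
      exact ⟨hz.2, hclq x hx z hz.2 hz.1.symm⟩
    have hr2 : c / 2 + 2 ≤ r := hr ▸ core_card G' (c / 2) hneH
    have hrk : r ≤ c + 1 - k := by
      by_contra hlt
      have hall := all_adj (by omega) hconn' hNC' hmax (core G' (c / 2)) Finset.univ (r - 1) k
        hHd (fun y _ => (hdeg y).trans (Finset.card_le_card (by
          intro z hz
          rw [Finset.mem_filter] at *
          exact ⟨hz.1, hle hz.2⟩))) (by omega)
      have huniv : core G' (c / 2) = Finset.univ := by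
        rw [Finset.eq_univ_iff_forall]
        intro y
        exact core_join G' _ hneH y (fun x hx hxy => hall x hx y (Finset.mem_univ _) hxy)
      rw [huniv] at hclq
      obtain ⟨x, hx⟩ := hneH
      obtain ⟨y, hy⟩ := clique_path Finset.univ hclq x (Finset.mem_univ _)
      have hxy : x ≠ y := by
        intro e
        have := congrArg Finset.card (hy.eq_singleton e)
        rw [Finset.card_univ, hV, Finset.card_singleton] at this
        omega
      have := hNC' _ _ _ hy (hclq y (Finset.mem_univ _) x (Finset.mem_univ _) hxy.symm)
      rw [Finset.card_univ] at this
      omega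
    obtain ⟨j, hj⟩ : ∃ j, c + 1 - r = j := ⟨_, rfl⟩
    have hcore : core G' j = core G' (c / 2) := by
      apply Finset.Subset.antisymm _ (core_anti G' (by omega))
      have hall := all_adj (by omega) hconn' hNC' hmax (core G' (c / 2)) (core G' j) (r - 1)
        (j + 1) hHd (core_deg G' j) (by omega)
      intro y hy
      exact core_join G' _ hneH y (fun x hx hxy => hall x hx y hy hxy)
    have hpeel := cl_peel hle s (by omega) j (Finset.univ \ Q)
    rw [hcore] at hpeel
    have hcl := cl_le_choose G s ((Finset.univ \ Q) ∩ core G' (c / 2))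
    have hH0Q : core G (c / 2) ⊆ (Finset.univ \ Q) ∩ core G' (c / 2) := by
      intro v hv
      rw [Finset.mem_inter, Finset.mem_sdiff]
      refine ⟨⟨Finset.mem_univ _, fun hvQ => ?_⟩, hsub hv⟩
      have e1 := hQd v hvQ
      have e2 := core_deg G _ v hv
      have e3 := Finset.card_le_card (Finset.filter_subset_filter (fun z => G.Adj v z)
        (Finset.subset_univ (core G (c / 2))))
      omega
    have hH0c := Finset.card_le_card hH0Q
    have hinter : ((Finset.univ \ Q) ∩ core G' (c / 2)).card + (Q ∩ core G' (c / 2)).card = r := by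
      rw [← hr, ← Finset.card_union_of_disjoint]
      · congr 1; ext z; simp; tauto
      · rw [Finset.disjoint_left]; intro z; simp; tauto
    have hdiff := Finset.card_sdiff_add_card_inter (Finset.univ \ Q) (core G' (c / 2))
    rw [hWc] at hdiff
    obtain ⟨q0, hq0⟩ : ∃ q0, (Q ∩ core G' (c / 2)).card = q0 := ⟨_, rfl⟩
    obtain ⟨x, hx⟩ : ∃ x, ((Finset.univ \ Q) ∩ core G' (c / 2)).card = x := ⟨_, rfl⟩
    have hq0q : q0 ≤ q := by
      rw [← hq0, ← hQ]; exact Finset.card_le_card Finset.inter_subset_left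
    rw [hx] at hcl hinter hdiff hH0c
    rw [hq0] at hinter
    have hsw := choose_swap s j x q0 (by omega) (by omega)
    rw [hinter] at hsw
    have harith := arith n c k s q j h1 h6 h2 h4 (by omega) (by omega)
    refine le_trans ?_ harith
    have hy : ((Finset.univ \ Q) \ core G' (c / 2)).card = (n + j - q - c - 1) + q0 := by omega
    rw [hy, Nat.add_mul] at hpeel
    rw [show c + 1 - j = r by omega]
    omega

theorem stmt10 (n c k s q : ℕ) (h1 : c ≤ n - 1) (h2 : 2 * k ≤ c) (h3 : 2 ≤ k)
    (h4 : 2 ≤ s) (h5 : 1 ≤ q) (h6 : q ≤ k)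
    (V : Type) (G : SimpleGraph V) (hV : Nat.card V = n) (hconn : TwoConnected G)
    (hcirc : circ G = c) (hdeg : MinDegreeEq G k)
    (hq : q ≤ Nat.card {v : V // degN G v = k}) :
    cliquesN G s ≤ max (fCliques n c k s) (gCliquesQ n c k q s) := by
  classical
  have hfin : Finite V := Nat.finite_of_card_ne_zero (by have := hconn.1; omega)
  have hft : Fintype V := Fintype.ofFinite V
  have h3V := hconn.1
  have hdegN : ∀ v, degN G v = (Finset.univ.filter (fun z => G.Adj v z)).card := by
    intro v
    exact Nat.subtype_card _ (by simp)
  have hcl : cliquesN G s = cl G s Finset.univ := by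
    unfold cliquesN cl
    refine Nat.subtype_card _ ?_
    intro S
    rw [Finset.mem_filter, Finset.mem_powersetCard, isNClique_iff]
    simp [and_comm]
  have hqc : Nat.card {v : V // degN G v = k} =
      (Finset.univ.filter (fun v => degN G v = k)).card := Nat.subtype_card _ (by simp)
  rw [hqc] at hq
  obtain ⟨Q, hQs, hQc⟩ := Finset.exists_subset_card_eq hq
  rw [hcl]
  refine main_bound n c k s q (by omega) h2 h3 h4 h6 G (by rw [← hV, Nat.card_eq_fintype_card])
    (pconn_of_twoConnected G hconn) (noLong_of_circ G (by omega) hcirc) ?_ Q hQc ?_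
  · intro v
    exact (hdeg.1 v).trans (hdegN v).le
  · intro v hv
    rw [← hdegN v]
    exact (Finset.mem_filter.1 (hQs hv)).2
end

section
/- Let n ≥ 3 be an integer. Every nonhamiltonian graph G of order n satisfies e(G) ≤ C(n-1, 2) + 1, and equality holds if and only if G is isomorphic to K_1 ∨ (K_{n-2} + K_1) or to K_2 ∨ \overline{K_3}. -/
open SimpleGraph

/-- The exceptional Ore graph `K_2 ∨ \overline{K_3}`. -/
def oreGraph : SimpleGraph (Fin 5) where
  Adj x y := x ≠ y ∧ (x.val < 2 ∨ y.val < 2)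
  symm := ⟨by intro x y h; exact ⟨h.1.symm, h.2.symm⟩⟩
  loopless := ⟨by intro x h; exact h.1 rfl⟩


/-- A sequence enumerating a Hamilton cycle. -/
def HamSeq {V : Type} (G : SimpleGraph V) (n : ℕ) (p : ℕ → V) : Prop :=
  (∀ i < n, ∀ j < n, p i = p j → i = j) ∧ (∀ i, i + 1 < n → G.Adj (p i) (p (i + 1))) ∧
    G.Adj (p (n - 1)) (p 0)

lemma seq_surj {V : Type} [Fintype V] {n : ℕ} (hV : Fintype.card V = n) {p : ℕ → V}
    (h : ∀ i < n, ∀ j < n, p i = p j → i = j) (v : V) : ∃ i < n, p i = v := by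
  have hinj : Function.Injective (fun i : Fin n => p i) := by
    intro i j hij
    exact Fin.ext (h i i.2 j j.2 hij)
  have hb := (Fintype.bijective_iff_injective_and_card (fun i : Fin n => p i)).2
    ⟨hinj, by simp [hV]⟩
  obtain ⟨i, hi⟩ := hb.2 v
  exact ⟨i, i.2, hi⟩

lemma walk_of_seq {V : Type} (G : SimpleGraph V) (n : ℕ) (p : ℕ → V)
    (h : ∀ i, i + 1 < n → G.Adj (p i) (p (i + 1))) (k : ℕ) (hk : k < n) :
    ∃ w : G.Walk (p 0) (p k), w.support = (List.range (k + 1)).map p := by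
  induction k with
  | zero => exact ⟨Walk.nil, by simp⟩
  | succ k ih =>
    obtain ⟨w, hw⟩ := ih (by omega)
    refine ⟨w.concat (h k hk), ?_⟩
    rw [Walk.support_concat, hw, List.range_succ (n := k + 1)]
    simp

lemma ham_of_seq {V : Type} [Fintype V] {G : SimpleGraph V} {n : ℕ} (hn : 3 ≤ n)
    (hV : Fintype.card V = n) {p : ℕ → V} (h : HamSeq G n p) : IsHamiltonianGr G := by
  obtain ⟨h1, h2, h3⟩ := h
  obtain ⟨w, hw⟩ := walk_of_seq G n p h2 (n - 1) (by omega)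
  have hp : w.IsPath := by
    rw [Walk.isPath_def, hw]
    refine List.Nodup.map_on ?_ List.nodup_range
    intro x hx y hy hxy
    simp only [List.mem_range] at hx hy
    exact h1 x (by omega) y (by omega) hxy
  have hl : w.length + 1 = n := by
    rw [← Walk.length_support, hw]
    simp; omega
  refine ⟨_, Walk.cons h3 w, ?_, ?_⟩
  · rw [Walk.isCycle_iff_isPath_tail_and_le_length]
    constructor
    · simpa using hp
    · simp; omega
  · intro v
    obtain ⟨i, hi, rfl⟩ := seq_surj hV h1 v
    rw [Walk.support_cons, hw]
    refine List.mem_cons_of_mem _ (List.mem_map_of_mem ?_)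
    simp; omega

lemma seq_of_ham {V : Type} [Fintype V] {G : SimpleGraph V} {n : ℕ}
    (hV : Fintype.card V = n) (h : IsHamiltonianGr G) : ∃ p, HamSeq G n p := by
  classical
  obtain ⟨v, w, hw, hs⟩ := h
  have hlen : w.length = n := by
    rw [← hV]
    have : w.IsHamiltonianCycle := by
      refine ⟨hw, ?_⟩
      refine hw.isPath_tail.isHamiltonian_of_mem ?_
      intro u
      have := hs u
      rw [← Walk.cons_support_tail hw.not_nil] at this
      rcases List.mem_cons.1 this with rfl | h
      · exact Walk.end_mem_support _
      · exact h
    exact this.length_eq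
  have h3 := hw.three_le_length
  refine ⟨w.getVert, ?_, ?_, ?_⟩
  · intro i hi j hj hij
    exact hw.getVert_injOn' (by simp; omega) (by simp; omega) hij
  · intro i hi
    exact w.adj_getVert_succ (by omega)
  · have := w.adj_getVert_succ (i := n - 1) (by omega)
    rw [show n - 1 + 1 = w.length by omega, Walk.getVert_length] at this
    simpa using this

lemma cross {V : Type} [Fintype V] {G : SimpleGraph V} [DecidableRel G.Adj] {n : ℕ} (hn : 3 ≤ n)
    (hV : Fintype.card V = n) {p : ℕ → V}
    (h1 : ∀ i < n, ∀ j < n, p i = p j → i = j)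
    (h2 : ∀ i, i + 1 < n → G.Adj (p i) (p (i + 1)))
    (hd : n ≤ G.degree (p 0) + G.degree (p (n - 1))) : ∃ q, HamSeq G n q := by
  classical
  let S := (Finset.range (n - 1)).filter (fun i => G.Adj (p 0) (p (i + 1)))
  let T := (Finset.range (n - 1)).filter (fun i => G.Adj (p (n - 1)) (p i))
  have hS : G.degree (p 0) ≤ S.card := by
    rw [← card_neighborFinset_eq_degree]
    have : G.neighborFinset (p 0) ⊆ S.image (fun i => p (i + 1)) := by
      intro x hx
      rw [mem_neighborFinset] at hx
      obtain ⟨i, hi, rfl⟩ := seq_surj hV h1 x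
      rcases i with _ | i
      · exact absurd hx (G.irrefl)
      · refine Finset.mem_image.2 ⟨i, ?_, rfl⟩
        simp only [S, Finset.mem_filter, Finset.mem_range]
        exact ⟨by omega, hx⟩
    exact (Finset.card_le_card this).trans Finset.card_image_le
  have hT : G.degree (p (n - 1)) ≤ T.card := by
    rw [← card_neighborFinset_eq_degree]
    have : G.neighborFinset (p (n - 1)) ⊆ T.image p := by
      intro x hx
      rw [mem_neighborFinset] at hx
      obtain ⟨i, hi, rfl⟩ := seq_surj hV h1 x
      have : i ≠ n - 1 := by
        rintro rfl
        exact G.irrefl hx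
      refine Finset.mem_image.2 ⟨i, ?_, rfl⟩
      simp only [T, Finset.mem_filter, Finset.mem_range]
      exact ⟨by omega, hx⟩
    exact (Finset.card_le_card this).trans Finset.card_image_le
  have hU : (S ∪ T).card ≤ n - 1 := by
    have : S ∪ T ⊆ Finset.range (n - 1) :=
      Finset.union_subset (Finset.filter_subset _ _) (Finset.filter_subset _ _)
    simpa using Finset.card_le_card this
  have hI := Finset.card_union_add_card_inter S T
  obtain ⟨i, hi⟩ : (S ∩ T).Nonempty := by
    rw [← Finset.card_pos]; omega
  simp only [S, T, Finset.mem_inter, Finset.mem_filter, Finset.mem_range] at hi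
  obtain ⟨⟨hi, ha⟩, -, hb⟩ := hi
  refine ⟨fun j => if j ≤ i then p j else p (n + i - j), ?_, ?_, ?_⟩
  · intro a ha b hb hab
    simp only at hab
    split_ifs at hab <;> have := h1 _ (by omega) _ (by omega) hab <;> omega
  · intro j hj
    simp only
    rcases lt_trichotomy j i with h | h | h
    · rw [if_pos (by omega), if_pos (by omega)]; exact h2 j hj
    · subst h
      rw [if_pos le_rfl, if_neg (by omega), show n + j - (j + 1) = n - 1 by omega]
      exact hb.symm
    · rw [if_neg (by omega), if_neg (by omega)]
      have := h2 (n + i - (j + 1)) (by omega)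
      rw [show n + i - (j + 1) + 1 = n + i - j by omega] at this
      exact this.symm
  · simp only
    rw [if_neg (by omega), if_pos (by omega), show n + i - (n - 1) = i + 1 by omega]
    exact ha.symm

lemma rotate_seq {V : Type} {G : SimpleGraph V} {n : ℕ} {p : ℕ → V}
    (h : HamSeq G n p) {k : ℕ} (hk : k + 1 < n) : 
    HamSeq G n (fun i => if i + k + 1 < n then p (i + k + 1) else p (i + k + 1 - n)) := by
  obtain ⟨h1, h2, h3⟩ := h
  refine ⟨?_, ?_, ?_⟩
  · intro a ha b hb hab
    simp only at hab
    split_ifs at hab <;> have := h1 _ (by omega) _ (by omega) hab <;> omega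
  · intro j hj
    simp only
    rcases lt_trichotomy (j + k + 2) n with h | h | h
    · rw [if_pos (by omega), if_pos (by omega)]
      have := h2 (j + k + 1) (by omega)
      rwa [show j + 1 + k + 1 = j + k + 1 + 1 by omega]
    · rw [if_pos (by omega), if_neg (by omega), show j + k + 1 = n - 1 by omega,
        show j + 1 + k + 1 - n = 0 by omega]
      exact h3
    · rw [if_neg (by omega), if_neg (by omega)]
      have := h2 (j + k + 1 - n) (by omega)
      rwa [show j + k + 1 - n + 1 = j + 1 + k + 1 - n by omega] at this
  · simp only
    rw [if_neg (by omega), if_pos (by omega), show n - 1 + k + 1 - n = k by omega, zero_add]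
    exact h2 k hk

/-- The Bondy-Chvátal closure step. -/
lemma closure_step {V : Type} [Fintype V] {G : SimpleGraph V} [DecidableRel G.Adj] {n : ℕ}
    (hn : 3 ≤ n) (hV : Fintype.card V = n) {u v : V} 
    (hd : n ≤ G.degree u + G.degree v) (hh : IsHamiltonianGr (G ⊔ edge u v)) :
    IsHamiltonianGr G := by
  obtain ⟨p, hp⟩ := seq_of_ham hV hh
  -- it suffices to treat a sequence whose closing pair is the new edge
  have key : ∀ q : ℕ → V, HamSeq (G ⊔ edge u v) n q → ¬ G.Adj (q (n - 1)) (q 0) →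
      IsHamiltonianGr G := by
    intro q hq hna
    obtain ⟨h1, h2, h3⟩ := hq
    have hc : (q (n - 1) = u ∧ q 0 = v) ∨ (q (n - 1) = v ∧ q 0 = u) := by
      rw [sup_adj, edge_adj] at h3
      tauto
    have h2' : ∀ i, i + 1 < n → G.Adj (q i) (q (i + 1)) := by
      intro i hi
      have h := h2 i hi
      rw [sup_adj, edge_adj] at h
      rcases h with h | ⟨h, -⟩
      · exact h
      · exfalso
        have e : (q i = q (n - 1) ∧ q (i + 1) = q 0) ∨ (q i = q 0 ∧ q (i + 1) = q (n - 1)) := by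
          rcases hc with ⟨a, b⟩ | ⟨a, b⟩ <;> rw [a, b] <;> tauto
        rcases e with ⟨e, e'⟩ | ⟨e, e'⟩
        · have := h1 _ hi 0 (by omega) e'
          omega
        · have := h1 _ (by omega) 0 (by omega) e
          have := h1 _ hi (n - 1) (by omega) e'
          omega
    have hd' : n ≤ G.degree (q 0) + G.degree (q (n - 1)) := by
      rcases hc with ⟨a, b⟩ | ⟨a, b⟩ <;> rw [a, b] <;> omega
    obtain ⟨r, hr⟩ := cross hn hV h1 h2' hd'
    exact ham_of_seq hn hV hr
  by_cases hlast : G.Adj (p (n - 1)) (p 0)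
  · by_cases hall : ∀ i, i + 1 < n → G.Adj (p i) (p (i + 1))
    · exact ham_of_seq hn hV ⟨hp.1, hall, hlast⟩
    · push Not at hall
      obtain ⟨k, hk, hna⟩ := hall
      refine key _ (rotate_seq hp hk) ?_
      rw [if_neg (by omega), if_pos (by omega), show n - 1 + k + 1 - n = k by omega, zero_add]
      exact hna
  · exact key p hp hlast

lemma ham_top_s13 {V : Type} [Fintype V] {n : ℕ} (hn : 3 ≤ n) (hV : Fintype.card V = n) :
    IsHamiltonianGr (⊤ : SimpleGraph V) := by
  let e : Fin n ≃ V := (Fintype.equivFinOfCardEq hV).symm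
  have h1 : ∀ i < n, ∀ j < n, (if h : i < n then e ⟨i, h⟩ else e ⟨0, by omega⟩) =
      (if h : j < n then e ⟨j, h⟩ else e ⟨0, by omega⟩) → i = j := by
    intro i hi j hj hij
    rw [dif_pos hi, dif_pos hj] at hij
    simpa using e.injective hij
  refine ham_of_seq hn hV (p := fun i => if h : i < n then e ⟨i, h⟩ else e ⟨0, by omega⟩)
    ⟨h1, ?_, ?_⟩
  · intro i hi
    rw [top_adj]
    intro h
    have := h1 _ (by omega) _ hi h
    omega
  · rw [top_adj]
    intro h
    have := h1 _ (by omega) _ (by omega) h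
    omega

lemma edgeCount_eq {V : Type} [Fintype V] (G : SimpleGraph V) [Fintype G.edgeSet] :
    edgeCount G = G.edgeFinset.card := by
  rw [edgeCount, Nat.card_eq_fintype_card, edgeFinset_card]

lemma edgeCount_compl {V : Type} [Fintype V] (G : SimpleGraph V) :
    edgeCount G + edgeCount Gᶜ = (Fintype.card V).choose 2 := by
  classical
  rw [edgeCount_eq, edgeCount_eq, ← card_edgeFinset_top_eq_card_choose_two,
    ← Finset.card_union_of_disjoint]
  · congr 1
    ext e
    induction e with | h x y => 
    simp only [Finset.mem_union, mem_edgeFinset, mem_edgeSet, compl_adj, top_adj]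
    have : G.Adj x y → x ≠ y := fun h => h.ne
    tauto
  · rw [disjoint_edgeFinset]
    exact disjoint_compl_right

lemma edgeCount_mono {V : Type} [Fintype V] {G H : SimpleGraph V} (h : G ≤ H) :
    edgeCount G ≤ edgeCount H ∧ (edgeCount G = edgeCount H → G = H) := by
  classical
  rw [edgeCount_eq, edgeCount_eq]
  have hs : G.edgeFinset ⊆ H.edgeFinset := edgeFinset_subset_edgeFinset.2 h
  refine ⟨Finset.card_le_card hs, fun he => ?_⟩
  exact edgeFinset_inj.1 (Finset.eq_of_subset_of_card_le hs he.ge)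

lemma max_pair {V : Type} [Fintype V] {G : SimpleGraph V} {n : ℕ} (hn : 3 ≤ n)
    (hV : Fintype.card V = n) (hG : Maximal (fun G => ¬ IsHamiltonianGr G) G) {u v : V}
    (huv : Gᶜ.Adj u v) :
    n - 2 ≤ edgeCount Gᶜ ∧ (edgeCount Gᶜ = n - 2 → ∀ x y, Gᶜ.Adj x y →
      x = u ∨ y = u ∨ x = v ∨ y = v) := by
  classical
  have hham : IsHamiltonianGr (G ⊔ edge u v) := by
    by_contra hc
    have := hG.2 hc le_sup_left
    have h' : G.Adj u v := this (by
      rw [sup_adj, edge_adj]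
      exact Or.inr ⟨Or.inl ⟨rfl, rfl⟩, huv.ne⟩)
    exact ((compl_adj _ _ _).1 huv).2 h'
  have hd : ¬ n ≤ G.degree u + G.degree v := fun hd => hG.1 (closure_step hn hV hd hham)
  have du := G.degree_compl (v := u)
  have dv := G.degree_compl (v := v)
  rw [hV] at du dv
  have hu := G.degree_lt_card_verts u
  have hv := G.degree_lt_card_verts v
  rw [hV] at hu hv
  have hI := Finset.card_union_add_card_inter (Gᶜ.incidenceFinset u) (Gᶜ.incidenceFinset v)
  have hI1 : (Gᶜ.incidenceFinset u ∩ Gᶜ.incidenceFinset v).card ≤ 1 := by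
    have : Gᶜ.incidenceFinset u ∩ Gᶜ.incidenceFinset v ⊆ {s(u, v)} := by
      intro e he
      rw [Finset.mem_inter, mem_incidenceFinset, mem_incidenceFinset] at he
      have := Gᶜ.incidenceSet_inter_incidenceSet_subset huv.ne he
      simpa using this
    simpa using Finset.card_le_card this
  rw [card_incidenceFinset_eq_degree, card_incidenceFinset_eq_degree] at hI
  have hs : Gᶜ.incidenceFinset u ∪ Gᶜ.incidenceFinset v ⊆ Gᶜ.edgeFinset :=
    Finset.union_subset (Gᶜ.incidenceFinset_subset u) (Gᶜ.incidenceFinset_subset v)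
  have hc := Finset.card_le_card hs
  rw [edgeCount_eq]
  refine ⟨by omega, fun he x y hxy => ?_⟩
  have heq := Finset.eq_of_subset_of_card_le hs (by omega)
  have hm : s(x, y) ∈ Gᶜ.edgeFinset := by rw [mem_edgeFinset]; exact hxy
  rw [← heq, Finset.mem_union, mem_incidenceFinset, mem_incidenceFinset,
    mk'_mem_incidenceSet_iff, mk'_mem_incidenceSet_iff] at hm
  rcases hm with ⟨-, rfl | rfl⟩ | ⟨-, rfl | rfl⟩ <;> simp

lemma choose_split {n : ℕ} (hn : 3 ≤ n) : n.choose 2 = (n - 1).choose 2 + 1 + (n - 2) := by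
  obtain ⟨m, rfl⟩ : ∃ m, n = m + 1 := ⟨n - 1, by omega⟩
  rw [Nat.choose_succ_succ' m 1]
  simp; omega

lemma exists_compl_adj {V : Type} [Fintype V] {G : SimpleGraph V} {n : ℕ} (hn : 3 ≤ n)
    (hV : Fintype.card V = n) (hG : ¬ IsHamiltonianGr G) : ∃ u v, Gᶜ.Adj u v := by
  by_contra hc
  push Not at hc
  apply hG
  have : G = ⊤ := by
    ext x y
    rw [top_adj]
    refine ⟨fun h => h.ne, fun h => ?_⟩
    by_contra h'
    exact hc x y ((compl_adj _ _ _).2 ⟨h, h'⟩)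
  rw [this]
  exact ham_top_s13 hn hV

lemma main_bound_s13 {V : Type} [Fintype V] {G : SimpleGraph V} {n : ℕ} (hn : 3 ≤ n)
    (hV : Fintype.card V = n) (hG : ¬ IsHamiltonianGr G) :
    n - 2 ≤ edgeCount Gᶜ ∧
      (edgeCount Gᶜ = n - 2 → Maximal (fun G => ¬ IsHamiltonianGr G) G) := by
  classical
  obtain ⟨M, hGM, hM⟩ := Finite.exists_le_maximal (p := fun G => ¬ IsHamiltonianGr G) hG
  obtain ⟨u, v, huv⟩ := exists_compl_adj hn hV hM.1
  have h1 := (max_pair hn hV hM huv).1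
  have h2 := edgeCount_mono (compl_le_compl hGM)
  refine ⟨h1.trans h2.1, fun he => ?_⟩
  have := h2.2 (by omega)
  rw [← compl_injective this]
  exact hM

/-- Structure of the complement in the extremal case: a star or a triangle. -/
lemma star_or_triangle {V : Type} {H : SimpleGraph V} {a b : V} (hab : H.Adj a b)
    (h : ∀ u v, H.Adj u v → ∀ x y, H.Adj x y → x = u ∨ y = u ∨ x = v ∨ y = v) :
    (∃ c, ∀ x y, H.Adj x y → x = c ∨ y = c) ∨
    ∃ u v w, u ≠ v ∧ u ≠ w ∧ v ≠ w ∧ ∀ x y, H.Adj x y ↔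
      x ≠ y ∧ (x = u ∨ x = v ∨ x = w) ∧ (y = u ∨ y = v ∨ y = w) := by
  by_cases ha : ∀ x y, H.Adj x y → x = a ∨ y = a
  · exact Or.inl ⟨a, ha⟩
  by_cases hb : ∀ x y, H.Adj x y → x = b ∨ y = b
  · exact Or.inl ⟨b, hb⟩
  right
  push Not at ha hb
  obtain ⟨w, hbw, hwa⟩ : ∃ w, H.Adj b w ∧ w ≠ a := by
    obtain ⟨x, y, hxy, h1, h2⟩ := ha
    rcases h a b hab x y hxy with rfl | rfl | rfl | rfl
    · exact absurd rfl h1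
    · exact absurd rfl h2
    · exact ⟨y, hxy, h2⟩
    · exact ⟨x, hxy.symm, h1⟩
  obtain ⟨w', haw, hwb⟩ : ∃ w, H.Adj a w ∧ w ≠ b := by
    obtain ⟨x, y, hxy, h1, h2⟩ := hb
    rcases h a b hab x y hxy with rfl | rfl | rfl | rfl
    · exact ⟨y, hxy, h2⟩
    · exact ⟨x, hxy.symm, h1⟩
    · exact absurd rfl h1
    · exact absurd rfl h2
  have hw : w' = w := by
    have := h _ _ hbw _ _ haw
    have := hab.ne
    grind
  subst hw
  refine ⟨a, b, w', hab.ne, haw.ne, hbw.ne, fun x y => ⟨fun hxy => ?_, ?_⟩⟩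
  · have e1 := h _ _ hab _ _ hxy
    have e2 := h _ _ hbw _ _ hxy
    have e3 := h _ _ haw _ _ hxy
    have := hxy.ne
    have := hab.ne
    have := haw.ne
    have := hbw.ne
    refine ⟨hxy.ne, ?_⟩
    grind
  · rintro ⟨hne, rfl | rfl | rfl, rfl | rfl | rfl⟩ <;>
      first | exact absurd rfl hne | assumption | exact SimpleGraph.Adj.symm (by assumption)

lemma iso_star {V : Type} [Fintype V] {G : SimpleGraph V} {n : ℕ} (hn : 3 ≤ n)
    (hV : Fintype.card V = n) {c : V} (hc : ∀ x y, Gᶜ.Adj x y → x = c ∨ y = c)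
    (he : edgeCount Gᶜ = n - 2) : Nonempty (G ≃g Fgraph n (n - 1) 1) := by
  classical
  have hinc : Gᶜ.edgeFinset = Gᶜ.incidenceFinset c := by
    ext e
    induction e with | h x y =>
    rw [mem_edgeFinset, mem_incidenceFinset, mk'_mem_incidenceSet_iff, mem_edgeSet]
    have := hc x y
    grind
  rw [edgeCount_eq, hinc, card_incidenceFinset_eq_degree] at he
  have du := G.degree_compl (v := c)
  have hu := G.degree_lt_card_verts c
  have hd : G.degree c = 1 := by omega
  obtain ⟨z, hz, hz'⟩ := (G.degree_eq_one_iff_existsUnique_adj).1 hd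
  have hzc : z ≠ c := hz.ne'
  have hadj : ∀ x y, G.Adj x y ↔ x ≠ y ∧ ((x ≠ c ∧ y ≠ c) ∨ (x = c ∧ y = z) ∨ (x = z ∧ y = c)) := by
    intro x y
    have h1 := hc x y
    rw [compl_adj] at h1
    have h2 : G.Adj x y → x ≠ y := fun h => h.ne
    have h3 : G.Adj x y → G.Adj y x := fun h => h.symm
    have h4 := hz.symm
    have h5 := hz' x
    have h6 := hz' y
    grind
  let e : V ≃ Fin n := Fintype.equivFinOfCardEq hV
  let l : Fin n := ⟨n - 1, by omega⟩
  let o : Fin n := ⟨0, by omega⟩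
  have hol : o ≠ l := by simp [o, l, Fin.ext_iff]; omega
  let e1 := e.trans (Equiv.swap (e c) l)
  let e2 := e1.trans (Equiv.swap (e1 z) o)
  have h1c : e1 c = l := by simp [e1]
  have h2z : e2 z = o := by simp [e2]
  have h2c : e2 c = l := by
    simp only [e2, Equiv.trans_apply, h1c]
    refine Equiv.swap_apply_of_ne_of_ne ?_ hol.symm
    rw [← h1c]
    exact fun h => hzc (e1.injective h).symm
  refine ⟨⟨e2, ?_⟩⟩
  intro x y
  rw [hadj]
  have exc : ∀ x, x = c ↔ (e2 x).val = n - 1 := fun x => by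
    rw [← e2.injective.eq_iff, h2c, Fin.ext_iff]
  have exz : ∀ x, x = z ↔ (e2 x).val = 0 := fun x => by
    rw [← e2.injective.eq_iff, h2z, Fin.ext_iff]
  have exy : x = y ↔ (e2 x).val = (e2 y).val := by
    rw [← e2.injective.eq_iff, Fin.ext_iff]
  have hx := (e2 x).2
  have hy := (e2 y).2
  simp only [Fgraph, ne_eq, exc, exz, exy, Fin.ext_iff]
  omega

lemma iso_ore {V : Type} [Fintype V] {G : SimpleGraph V} {n : ℕ} (hn : 3 ≤ n)
    (hV : Fintype.card V = n) {u v w : V} (huv : u ≠ v) (huw : u ≠ w) (hvw : v ≠ w)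
    (hc : ∀ x y, Gᶜ.Adj x y ↔
      x ≠ y ∧ (x = u ∨ x = v ∨ x = w) ∧ (y = u ∨ y = v ∨ y = w))
    (he : edgeCount Gᶜ = n - 2) : Nonempty (G ≃g oreGraph) := by
  classical
  have hE : Gᶜ.edgeFinset = {s(u, v), s(u, w), s(v, w)} := by
    ext e
    induction e with | h x y =>
    rw [mem_edgeFinset, mem_edgeSet, hc]
    simp only [Finset.mem_insert, Finset.mem_singleton, Sym2.eq_iff]
    grind
  have hcard : Gᶜ.edgeFinset.card = 3 := by
    rw [hE, Finset.card_eq_three]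
    refine ⟨_, _, _, ?_, ?_, ?_, rfl⟩ <;> simp only [ne_eq, Sym2.eq_iff] <;> grind
  rw [edgeCount_eq, hcard] at he
  obtain rfl : n = 5 := by omega
  have hadj : ∀ x y, G.Adj x y ↔ x ≠ y ∧ ((x ≠ u ∧ x ≠ v ∧ x ≠ w) ∨ (y ≠ u ∧ y ≠ v ∧ y ≠ w)) := by
    intro x y
    have h1 := hc x y
    rw [compl_adj] at h1
    have h2 : G.Adj x y → x ≠ y := fun h => h.ne
    grind
  let e : V ≃ Fin 5 := Fintype.equivFinOfCardEq hV
  let e1 := e.trans (Equiv.swap (e u) 2)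
  let e2 := e1.trans (Equiv.swap (e1 v) 3)
  let e3 := e2.trans (Equiv.swap (e2 w) 4)
  have h1u : e1 u = 2 := by simp [e1]
  have h2v : e2 v = 3 := by simp [e2]
  have h3w : e3 w = 4 := by simp [e3]
  have h2u : e2 u = 2 := by
    simp only [e2, Equiv.trans_apply, h1u]
    refine Equiv.swap_apply_of_ne_of_ne ?_ (by decide)
    rw [← h1u]
    exact fun h => huv (e1.injective h)
  have h3u : e3 u = 2 := by
    simp only [e3, Equiv.trans_apply, h2u]
    refine Equiv.swap_apply_of_ne_of_ne ?_ (by decide)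
    rw [← h2u]
    exact fun h => huw (e2.injective h)
  have h3v : e3 v = 3 := by
    simp only [e3, Equiv.trans_apply, h2v]
    refine Equiv.swap_apply_of_ne_of_ne ?_ (by decide)
    rw [← h2v]
    exact fun h => hvw (e2.injective h)
  refine ⟨⟨e3, ?_⟩⟩
  intro x y
  rw [hadj]
  have exu : ∀ x, x = u ↔ (e3 x).val = 2 := fun x => by
    rw [← e3.injective.eq_iff, h3u, Fin.ext_iff]; rfl
  have exv : ∀ x, x = v ↔ (e3 x).val = 3 := fun x => by
    rw [← e3.injective.eq_iff, h3v, Fin.ext_iff]; rfl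
  have exw : ∀ x, x = w ↔ (e3 x).val = 4 := fun x => by
    rw [← e3.injective.eq_iff, h3w, Fin.ext_iff]; rfl
  have exy : x = y ↔ (e3 x).val = (e3 y).val := by
    rw [← e3.injective.eq_iff, Fin.ext_iff]
  have hx := (e3 x).2
  have hy := (e3 y).2
  simp only [oreGraph, ne_eq, exu, exv, exw, exy, Fin.ext_iff]
  omega

lemma edgeCount_iso {V W : Type} {G : SimpleGraph V} {H : SimpleGraph W} (f : G ≃g H) :
    edgeCount G = edgeCount H := Nat.card_congr f.mapEdgeSet

lemma edgeCount_F {n : ℕ} (hn : 3 ≤ n) :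
    edgeCount (Fgraph n (n - 1) 1) = (n - 1).choose 2 + 1 := by
  classical
  have h := edgeCount_compl (Fgraph n (n - 1) 1)
  rw [Fintype.card_fin, choose_split hn] at h
  let l : Fin n := ⟨n - 1, by omega⟩
  let o : Fin n := ⟨0, by omega⟩
  have hinc : (Fgraph n (n - 1) 1)ᶜ.edgeFinset = (Fgraph n (n - 1) 1)ᶜ.incidenceFinset l := by
    ext e
    induction e with | h x y =>
    rw [mem_edgeFinset, mem_incidenceFinset, mk'_mem_incidenceSet_iff, mem_edgeSet]
    refine ⟨fun h => ⟨h, ?_⟩, fun h => h.1⟩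
    simp only [compl_adj, Fgraph, ne_eq, Fin.ext_iff] at h
    simp only [Fin.ext_iff, l]
    have := x.2
    have := y.2
    omega
  have hdeg : (Fgraph n (n - 1) 1).degree l = 1 := by
    rw [degree_eq_one_iff_existsUnique_adj]
    refine ⟨o, ?_, ?_⟩
    · simp only [Fgraph, ne_eq, Fin.ext_iff, l, o]
      omega
    · intro y hy
      simp only [Fgraph, ne_eq, Fin.ext_iff, l] at hy
      simp only [Fin.ext_iff, o]
      omega
  have du := (Fgraph n (n - 1) 1).degree_compl (v := l)
  rw [edgeCount_eq (Fgraph n (n - 1) 1)ᶜ, hinc, card_incidenceFinset_eq_degree, du, hdeg,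
    Fintype.card_fin] at h
  omega

instance decOre : DecidableRel oreGraph.Adj := fun x y =>
  inferInstanceAs (Decidable (x ≠ y ∧ (x.val < 2 ∨ y.val < 2)))

lemma edgeCount_ore : edgeCount oreGraph = 7 := by
  rw [edgeCount_eq]
  decide

theorem stmt13 (n : ℕ) (hn : 3 ≤ n) (V : Type) (G : SimpleGraph V)
    (hV : Nat.card V = n) (hham : ¬ IsHamiltonianGr G) :
    edgeCount G ≤ Nat.choose (n - 1) 2 + 1 ∧
    (edgeCount G = Nat.choose (n - 1) 2 + 1 ↔
      Nonempty (G ≃g Fgraph n (n - 1) 1) ∨ Nonempty (G ≃g oreGraph)) := by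
  classical
  have : Finite V := Nat.finite_of_card_ne_zero (by omega)
  have := Fintype.ofFinite V
  have hV' : Fintype.card V = n := by rw [← Nat.card_eq_fintype_card, hV]
  have hsum := edgeCount_compl G
  rw [hV', choose_split hn] at hsum
  obtain ⟨hb, hmax⟩ := main_bound_s13 hn hV' hham
  refine ⟨by omega, fun he => ?_, ?_⟩
  · have hec : edgeCount Gᶜ = n - 2 := by omega
    have hM := hmax hec
    obtain ⟨a, b, hab⟩ := exists_compl_adj hn hV' hham
    rcases star_or_triangle hab (fun u v huv => (max_pair hn hV' hM huv).2 hec) with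
      ⟨c, hc⟩ | ⟨u, v, w, huv, huw, hvw, hc⟩
    · exact Or.inl (iso_star hn hV' hc hec)
    · exact Or.inr (iso_ore hn hV' huv huw hvw hc hec)
  · rintro (⟨⟨f⟩⟩ | ⟨⟨f⟩⟩)
    · rw [edgeCount_iso f, edgeCount_F hn]
    · have h5 : n = 5 := by
        rw [← hV, Nat.card_congr f.toEquiv]; simp
      subst h5
      rw [edgeCount_iso f, edgeCount_ore]
      rfl
end

section
/- Let n ≥ 3 and k be integers with 1 ≤ k ≤ ⌊(n-1)/2⌋, and set h(n,k) = C(n-k, 2) + k². If G is a nonhamiltonian graph of order n with minimum degree δ(G) ≥ k, then e(G) ≤ max{h(n,k), h(n, ⌊(n-1)/2⌋)}. -/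
open SimpleGraph

theorem ham_of_path {V : Type*} [Fintype V] [DecidableEq V] (G : SimpleGraph V)
    (hn : 3 ≤ Fintype.card V) {u v : V} (p : G.Walk u v) (hp : p.IsHamiltonian)
    (h : G.Adj v u) : IsHamiltonianGr G := by
  refine ⟨v, Walk.cons h p, ?_, fun w => by simp [hp.mem_support]⟩
  rw [Walk.cons_isCycle_iff]
  refine ⟨hp.isPath, fun he => ?_⟩
  have h1 := hp.isPath.length_eq_one_of_mem_edges (Sym2.eq_swap ▸ he)
  have h2 := hp.length_eq
  omega

theorem ham_iff {V : Type*} [Fintype V] [DecidableEq V] (G : SimpleGraph V)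
    (h : IsHamiltonianGr G) (u : V) : ∃ c : G.Walk u u, c.IsHamiltonianCycle := by
  obtain ⟨a, w, hw, hs⟩ := h
  have : w.IsHamiltonianCycle := by
    refine ⟨hw, hw.isPath_tail.isHamiltonian_of_mem fun x => ?_⟩
    rw [Walk.support_tail_of_not_nil _ hw.not_nil]
    have hx := hs x
    rw [← Walk.cons_tail_support, List.mem_cons] at hx
    rcases hx with rfl | hx
    · exact Walk.end_mem_tail_support hw.not_nil
    · exact hx
  exact ⟨w.rotate u (hs u), by simpa using this⟩

theorem crossing {V : Type*} [Fintype V] [DecidableEq V] (G : SimpleGraph V)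
    (hn : 3 ≤ Fintype.card V) {u v : V} (p : G.Walk u v) (hp : p.IsHamiltonian)
    (i : ℕ) (hi : i < p.length) (h1 : G.Adj u (p.getVert (i + 1)))
    (h2 : G.Adj v (p.getVert i)) : IsHamiltonianGr G := by
  let q : G.Walk u (p.getVert (i + 1)) :=
    (p.take i).append (Walk.cons h2.symm (p.drop (i + 1)).reverse)
  have hq : q.support.Perm p.support := by
    have e : q.support = p.support.take (i+1) ++ (p.support.drop (i + 1)).reverse := by
      simp only [q, Walk.support_append, Walk.support_cons, List.tail_cons, Walk.support_reverse,
        Walk.support_take, Walk.drop_support_eq_support_drop_min]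
      rw [Nat.min_eq_left (by omega)]
    rw [e]
    conv_rhs => rw [← List.take_append_drop (i+1) p.support]
    exact (List.reverse_perm _).append_left _
  exact ham_of_path G hn q (fun a => by rw [hq.count_eq]; exact hp a) h1.symm

theorem ore {V : Type*} [Fintype V] [DecidableEq V] (G : SimpleGraph V) [DecidableRel G.Adj]
    (hn : 3 ≤ Fintype.card V) {u v : V} (p : G.Walk u v) (hp : p.IsHamiltonian)
    (hG : ¬ IsHamiltonianGr G) : G.degree u + G.degree v + 1 ≤ Fintype.card V := by
  have hL := hp.length_eq
  let A := (Finset.range p.length).filter fun i => G.Adj u (p.getVert (i + 1))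
  let B := (Finset.range p.length).filter fun i => G.Adj v (p.getVert i)
  have hA : G.degree u ≤ A.card := by
    rw [← G.card_neighborFinset_eq_degree]
    refine (Finset.card_le_card (t := A.image fun i => p.getVert (i + 1)) ?_).trans
      Finset.card_image_le
    intro x hx
    rw [mem_neighborFinset] at hx
    obtain ⟨j, rfl, hj⟩ := (Walk.mem_support_iff_exists_getVert).1 (hp.mem_support x)
    rcases j with _ | j
    · simp at hx
    · exact Finset.mem_image.2 ⟨j, by simp [A, hx]; omega, rfl⟩
  have hB : G.degree v ≤ B.card := by
    rw [← G.card_neighborFinset_eq_degree]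
    refine (Finset.card_le_card (t := B.image fun i => p.getVert i) ?_).trans
      Finset.card_image_le
    intro x hx
    rw [mem_neighborFinset] at hx
    obtain ⟨j, rfl, hj⟩ := (Walk.mem_support_iff_exists_getVert).1 (hp.mem_support x)
    rcases hj.lt_or_eq with hj | rfl
    · exact Finset.mem_image.2 ⟨j, by simp [B, hx]; omega, rfl⟩
    · simp at hx
  have hAB : Disjoint A B := by
    rw [Finset.disjoint_left]
    intro i hi hi'
    simp only [A, B, Finset.mem_filter, Finset.mem_range] at hi hi'
    exact hG (crossing G hn p hp i hi.1 hi.2 hi'.2)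
  have := Finset.card_union_of_disjoint hAB
  have h3 : (A ∪ B).card ≤ (Finset.range p.length).card :=
    Finset.card_le_card (Finset.union_subset (Finset.filter_subset _ _) (Finset.filter_subset _ _))
  rw [Finset.card_range] at h3
  omega

theorem cyc_start {V : Type*} [Fintype V] [DecidableEq V] (G H : SimpleGraph V) {u v : V}
    (hGH : ∀ x y, H.Adj x y → s(x, y) ≠ s(u, v) → G.Adj x y)
    (c : H.Walk u u) (hc : c.IsHamiltonianCycle) (hv : c.snd = v) :
    ∃ p : G.Walk v u, p.IsHamiltonian := by
  subst hv
  have hnot : s(u, c.snd) ∉ c.tail.edges := by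
    have := hc.isCycle
    rw [← Walk.cons_tail_eq c hc.isCycle.not_nil, Walk.cons_isCycle_iff] at this
    exact this.2
  have ht : ∀ e ∈ c.tail.edges, e ∈ G.edgeSet := by
    intro e he
    induction e with | h x y
    exact hGH x y (Walk.adj_of_mem_edges _ he) (fun h => hnot (h ▸ he))
  refine ⟨c.tail.transfer G ht, fun a => ?_⟩
  rw [Walk.support_transfer]
  exact hc.isHamiltonian_tail a

theorem ham_path_s14 {V : Type*} [Fintype V] [DecidableEq V] (G H : SimpleGraph V) {u v : V}
    (hGH : ∀ x y, H.Adj x y → s(x, y) ≠ s(u, v) → G.Adj x y)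
    (hG : ¬ IsHamiltonianGr G) (hH : IsHamiltonianGr H) :
    ∃ p : G.Walk v u, p.IsHamiltonian := by
  obtain ⟨c, hc⟩ := ham_iff H hH u
  by_cases he : s(u, v) ∈ c.edges
  · by_cases hs : c.snd = v
    · exact cyc_start G H hGH c hc hs
    · have hcc := hc.isCycle
      have h2 : c.reverse.IsHamiltonianCycle := by
        rw [Walk.isHamiltonianCycle_iff_isCycle_and_length_eq] at hc ⊢
        exact ⟨hc.1.reverse, by simpa using hc.2⟩
      refine cyc_start G H hGH c.reverse h2 ?_
      rw [Walk.snd_reverse]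
      have he' := he
      rw [← Walk.cons_tail_eq c hcc.not_nil, Walk.edges_cons, List.mem_cons] at he'
      rcases he' with he' | he'
      · exfalso; apply hs
        rw [Sym2.eq_iff] at he'
        rcases he' with h | h
        · exact h.2.symm
        · rw [h.2, ← h.1]
      · have h3 := hcc.isPath_tail.eq_penultimate_of_mem_edges he'
        have hnil : ¬ c.tail.Nil := fun h => by
          rw [Walk.edges_eq_nil.2 h] at he'
          simp at he'
        have h4 := Walk.penultimate_cons_of_not_nil (c.adj_snd hcc.not_nil) c.tail hnil
        rw [Walk.cons_tail_eq c hcc.not_nil] at h4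
        rw [h3, h4]
  · exfalso
    apply hG
    have ht : ∀ e ∈ c.edges, e ∈ G.edgeSet := by
      intro e h
      induction e with | h x y
      exact hGH x y (Walk.adj_of_mem_edges _ h) (fun h' => he (h' ▸ h))
    exact ⟨u, c.transfer G ht, hc.isCycle.transfer ht, fun x => by simp [hc.mem_support]⟩

theorem edge_bound {V : Type*} [Fintype V] [DecidableEq V] (G : SimpleGraph V)
    [DecidableRel G.Adj] (D : Finset V) (d : ℕ) (hD : D.card = d) (hd : ∀ x ∈ D, G.degree x ≤ d) :
    G.edgeFinset.card ≤ (Fintype.card V - d).choose 2 + d ^ 2 := by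
  have hsub : G.edgeFinset ⊆ (Dᶜ.offDiag.image Sym2.mk.uncurry) ∪ D.biUnion (fun x => G.incidenceFinset x) := by
    intro e he
    induction e with | h x y
    rw [mem_edgeFinset, mem_edgeSet] at he
    by_cases hx : x ∈ D
    · exact Finset.mem_union_right _ (Finset.mem_biUnion.2 ⟨x, hx, by simp [mk'_mem_incidenceSet_iff, he]⟩)
    by_cases hy : y ∈ D
    · exact Finset.mem_union_right _ (Finset.mem_biUnion.2 ⟨y, hy, by simp [mk'_mem_incidenceSet_iff, he]⟩)
    · exact Finset.mem_union_left _ (Finset.mem_image.2 ⟨(x, y), by simp [hx, hy, he.ne], rfl⟩)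
  refine (Finset.card_le_card hsub).trans ((Finset.card_union_le _ _).trans ?_)
  have h1 := Sym2.card_image_offDiag Dᶜ
  rw [Finset.card_compl, hD] at h1
  have h2 : (D.biUnion (fun x => G.incidenceFinset x)).card ≤ D.card * d :=
    Finset.card_biUnion_le_card_mul _ _ _ fun x hx => by
      rw [card_incidenceFinset_eq_degree]; exact hd x hx
  rw [hD, ← pow_two] at h2
  exact Nat.add_le_add h1.le h2

theorem convex_bound (n k d m : ℕ) (hk : k ≤ d) (hd : d ≤ m) (hm : m ≤ n) :
    (n - d).choose 2 + d ^ 2 ≤ max ((n - k).choose 2 + k ^ 2) ((n - m).choose 2 + m ^ 2) := by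
  have key : ∀ t ≤ n, (2 : ℤ) * (((n - t).choose 2 + t ^ 2 : ℕ) : ℤ)
      = ((n : ℤ) - t) * (n - t - 1) + 2 * t ^ 2 := by
    intro t ht
    obtain ⟨r, rfl⟩ := Nat.exists_eq_add_of_le ht
    have : t + r - t = r := by omega
    rw [this]
    have h := Nat.choose_two_right r
    have h2 : 2 * r.choose 2 = r * (r - 1) := by
      rw [h]; exact Nat.mul_div_cancel' (Nat.even_mul_pred_self r).two_dvd
    have h3 : (2 : ℤ) * (r.choose 2 : ℤ) = r * (r - 1) := by
      rcases r with _ | r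
      · simp
      · have := congrArg (Nat.cast (R := ℤ)) h2
        push_cast at this ⊢
        simpa using this
    push_cast
    linarith
  by_contra hcon
  rw [not_le, max_lt_iff] at hcon
  have a := key d (by omega)
  have b := key k (by omega)
  have c := key m hm
  have h1 : (((n - k).choose 2 + k ^ 2 : ℕ) : ℤ) < (((n - d).choose 2 + d ^ 2 : ℕ) : ℤ) := by
    exact_mod_cast hcon.1
  have h2 : (((n - m).choose 2 + m ^ 2 : ℕ) : ℤ) < (((n - d).choose 2 + d ^ 2 : ℕ) : ℤ) := by
    exact_mod_cast hcon.2
  have hk' : (k : ℤ) ≤ d := by exact_mod_cast hk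
  have hd' : (d : ℤ) ≤ m := by exact_mod_cast hd
  have e1 : 0 < ((d : ℤ) - k) * (3 * (d + k) - (2 * n - 1)) := by linarith
  have e2 : 0 < ((m : ℤ) - d) * ((2 * n - 1) - 3 * (m + d)) := by linarith
  have f1 := pos_of_mul_pos_right e1 (by linarith)
  have f2 := pos_of_mul_pos_right e2 (by linarith)
  linarith

theorem main_aux {V : Type*} [Fintype V] [DecidableEq V] (G : SimpleGraph V) [DecidableRel G.Adj]
    (hn : 3 ≤ Fintype.card V) (hG : ¬ IsHamiltonianGr G)
    (hmax : ∀ H, G < H → IsHamiltonianGr H) :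
    ∃ (D : Finset V) (u : V), D.card = G.degree u ∧ (∀ x ∈ D, G.degree x ≤ G.degree u) ∧
      2 * G.degree u + 1 ≤ Fintype.card V := by
  have hore : ∀ u v, u ≠ v → ¬ G.Adj u v → G.degree v + G.degree u + 1 ≤ Fintype.card V := by
    intro u v huv hadj
    have hlt : G < G ⊔ edge u v := by
      refine lt_of_le_of_ne le_sup_left fun h => hadj ?_
      rw [h]; simp [edge_adj, huv]
    obtain ⟨p, hp⟩ := ham_path_s14 (u := u) (v := v) G (G ⊔ edge u v) (by
      intro x y h hne
      rw [sup_adj, edge_adj] at h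
      rcases h with h | h
      · exact h
      · exact absurd (by rw [Sym2.eq_iff]; tauto) hne) hG (hmax _ hlt)
    exact ore G hn p hp hG
  have hne : ∃ u v, u ≠ v ∧ ¬ G.Adj u v := by
    by_contra hcon
    push Not at hcon
    apply hG
    have e := Fintype.equivFin V
    have hc : cycleGraph (Fintype.card V) ⊑ G :=
      ⟨⟨⟨e.symm, fun h => hcon _ _ (e.symm.injective.ne h.ne)⟩, e.symm.injective⟩⟩
    obtain ⟨v, p, hp, hl⟩ := (cycleGraph_isContained_iff (by omega)).1 hc
    have hh := Walk.isHamiltonianCycle_iff_isCycle_and_length_eq.2 ⟨hp, hl⟩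
    exact ⟨v, p, hp, hh.mem_support⟩
  obtain ⟨⟨u, v⟩, huv, hm⟩ := Finset.exists_max_image
    (Finset.univ.filter fun q : V × V => q.1 ≠ q.2 ∧ ¬ G.Adj q.1 q.2)
    (fun q => G.degree q.1 + G.degree q.2) (by
      obtain ⟨u, v, h⟩ := hne
      exact ⟨(u, v), by simpa using h⟩)
  simp only [Finset.mem_filter, Finset.mem_univ, true_and] at huv hm
  have main : ∀ u v, u ≠ v → ¬ G.Adj u v → G.degree u ≤ G.degree v →
      (∀ x, x ≠ v → ¬ G.Adj x v → G.degree x ≤ G.degree u) → ∃ (D : Finset V) (u : V), D.card = G.degree u ∧ (∀ x ∈ D, G.degree x ≤ G.degree u) ∧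
      2 * G.degree u + 1 ≤ Fintype.card V := by
    intro u v h1 h2 h3 h4
    have ho := hore u v h1 h2
    have hc : G.degree u ≤ ((insert v (G.neighborFinset v))ᶜ).card := by
      rw [Finset.card_compl]
      have := Finset.card_insert_le v (G.neighborFinset v)
      rw [card_neighborFinset_eq_degree] at this
      omega
    obtain ⟨D, hD, hDc⟩ := Finset.exists_subset_card_eq hc
    refine ⟨D, u, hDc, fun x hx => ?_, by omega⟩
    have := hD hx
    simp at this
    exact h4 x this.1 fun h => this.2 h.symm
  rcases le_total (G.degree u) (G.degree v) with h | h
  · exact main u v huv.1 huv.2 h fun x h1 h2 => by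
      have := hm (x, v) ⟨h1, h2⟩
      simp at this; exact this
  · exact main v u huv.1.symm (fun h => huv.2 h.symm) h fun x h1 h2 => by
      have := hm (x, u) ⟨h1, h2⟩
      simp at this; omega

theorem stmt14 (n k : ℕ) (hn : 3 ≤ n) (hk1 : 1 ≤ k) (hk2 : k ≤ (n - 1) / 2)
    (V : Type) (G : SimpleGraph V) (hV : Nat.card V = n)
    (hham : ¬ IsHamiltonianGr G) (hdeg : ∀ v, k ≤ degN G v) :
    edgeCount G ≤ max (Nat.choose (n - k) 2 + k ^ 2)
      (Nat.choose (n - (n - 1) / 2) 2 + ((n - 1) / 2) ^ 2) := by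
  classical
  have hfin : Finite V := Nat.finite_of_card_ne_zero (by omega)
  have := Fintype.ofFinite V
  rw [Nat.card_eq_fintype_card] at hV
  obtain ⟨M, hGM, hM⟩ := Finite.exists_le_maximal (p := fun H : SimpleGraph V => ¬ IsHamiltonianGr H) hham
  obtain ⟨D, u, h1, h2, h3⟩ := main_aux M (by omega) hM.1 (fun H hH => by
    by_contra hc
    exact absurd (hM.2 hc hH.le) (not_le_of_gt hH))
  have hb := edge_bound M D _ h1 h2
  have hle : edgeCount G ≤ M.edgeFinset.card := by
    unfold edgeCount
    rw [Nat.card_eq_fintype_card, ← edgeFinset_card]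
    exact Finset.card_le_card (edgeFinset_mono hGM)
  have hku : k ≤ M.degree u := by
    have := hdeg u
    unfold degN at this
    rw [Nat.card_eq_fintype_card, card_neighborSet_eq_degree] at this
    exact this.trans (degree_le_of_le hGM)
  rw [hV] at hb
  exact hle.trans (hb.trans (convex_bound n k _ _ hku (by omega) (by omega)))
end
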